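/- arXiv:1903.01805 — 2 statements merged into one kernel-verified Lean document; each statement's English description precedes it below -/
import Mathlib

section
/- In every 1-bend CPG representation of the graph G(v), at most one endpoint of the path P_v representing v is free; that is, P_v cannot have both of its endpoints belonging to no other path. -/
/-! ## Grid paths and CPG representations -/

/-- Two grid points of `ℤ × ℤ` at L¹-distance 1 (i.e. joined by a unit grid segment). -/
def GridStep (p q : ℤ × ℤ) : Prop :=
  (p.1 - q.1).natAbs + (p.2 - q.2).natAbs = 1

/-- A grid path: a sequence of at least two grid points, consecutive points at distance 1,
with no repeated grid point (so the traced curve neither crosses nor retraces itself). -/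
structure GridPath where
  pts : List (ℤ × ℤ)
  two_le_length : 2 ≤ pts.length
  step : pts.Chain' GridStep
  nodup : pts.Nodup

namespace GridPath

theorem ne_nil (P : GridPath) : P.pts ≠ [] := by
  intro h
  have h2 := P.two_le_length
  rw [h] at h2
  simp at h2

/-- The set of grid points of a grid path. -/
def toSet (P : GridPath) : Set (ℤ × ℤ) := {p | p ∈ P.pts}

/-- The first extreme point of a grid path. -/
def first (P : GridPath) : ℤ × ℤ := P.pts.head P.ne_nil

/-- The second extreme point of a grid path. -/
def last (P : GridPath) : ℤ × ℤ := P.pts.getLast P.ne_nil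

/-- `p` is an endpoint (extreme point) of the grid path `P`. -/
def IsEndpoint (P : GridPath) (p : ℤ × ℤ) : Prop := p = P.first ∨ p = P.last

/-- `p` is an interior grid point of `P`: it lies on `P` but is not an endpoint. -/
def IsInterior (P : GridPath) (p : ℤ × ℤ) : Prop := p ∈ P.toSet ∧ ¬ P.IsEndpoint p

/-- `p` is a bend of `P`: an interior grid point at which `P` turns 90 degrees. -/
def IsBend (P : GridPath) (p : ℤ × ℤ) : Prop :=
  ∃ a c : ℤ × ℤ, [a, p, c] <:+: P.pts ∧ a.1 ≠ c.1 ∧ a.2 ≠ c.2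

/-- The set of bend points of `P`. -/
def bendSet (P : GridPath) : Set (ℤ × ℤ) := {p | P.IsBend p}

/-- `P` has at most `k` bends. -/
def BendsAtMost (P : GridPath) (k : ℕ) : Prop := P.bendSet.ncard ≤ k

end GridPath

/-- `p` and `q` are consecutive grid points of the list `l` (in either order);
equivalently, the path traced by `l` uses the unit grid segment joining `p` and `q`. -/
def ConsecIn (l : List (ℤ × ℤ)) (p q : ℤ × ℤ) : Prop :=
  [p, q] <:+: l ∨ [q, p] <:+: l

/-- A CPG representation of a simple graph `G`: a family of pairwise interiorly disjoint
grid paths, one for each vertex, such that two distinct vertices are adjacent iff the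
corresponding paths have a common point. -/
structure CPGRep {V : Type*} (G : SimpleGraph V) where
  path : V → GridPath
  interiorly_disjoint : ∀ u v : V, u ≠ v → ∀ p : ℤ × ℤ,
    p ∈ (path u).toSet → p ∈ (path v).toSet →
    (path u).IsEndpoint p ∨ (path v).IsEndpoint p
  no_shared_segment : ∀ u v : V, u ≠ v → ∀ p q : ℤ × ℤ,
    ConsecIn (path u).pts p q → ¬ ConsecIn (path v).pts p q
  adj_iff : ∀ u v : V, u ≠ v →
    (G.Adj u v ↔ ∃ p : ℤ × ℤ, p ∈ (path u).toSet ∧ p ∈ (path v).toSet)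

namespace CPGRep

variable {V : Type*} {G : SimpleGraph V}

/-- A `k`-bend CPG representation: every path has at most `k` bends. -/
def BendsAtMost (R : CPGRep G) (k : ℕ) : Prop :=
  ∀ u : V, (R.path u).BendsAtMost k

/-- `p` is a free endpoint of the path of `u`: an endpoint of `R.path u`
belonging to no other path of the representation. -/
def FreeEndpoint (R : CPGRep G) (u : V) (p : ℤ × ℤ) : Prop :=
  (R.path u).IsEndpoint p ∧ ∀ v : V, v ≠ u → p ∉ (R.path v).toSet

end CPGRep

/-- A graph is CPG if it admits a CPG representation. -/
def IsCPG {V : Type*} (G : SimpleGraph V) : Prop := Nonempty (CPGRep G)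

/-- A graph is `B_k`-CPG if it admits a CPG representation in which every path
has at most `k` bends. -/
def IsBkCPG {V : Type*} (G : SimpleGraph V) (k : ℕ) : Prop :=
  ∃ R : CPGRep G, R.BendsAtMost k

/-! ## The graph `G(v)` -/

/-- The six vertices of the graph `G(v)`. -/
inductive GvV where
  | v : GvV
  | s : GvV
  | t : GvV
  | a : GvV
  | b : GvV
  | c : GvV

/-- The edges of `G(v)`: `vs`, `st`, `tv`, and every edge joining one of `a`, `b`, `c`
to one of `v`, `s`, `t`. -/
inductive GvRel : GvV → GvV → Prop
  | vs : GvRel GvV.v GvV.s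
  | st : GvRel GvV.s GvV.t
  | tv : GvRel GvV.t GvV.v
  | av : GvRel GvV.a GvV.v
  | as' : GvRel GvV.a GvV.s
  | at' : GvRel GvV.a GvV.t
  | bv : GvRel GvV.b GvV.v
  | bs : GvRel GvV.b GvV.s
  | bt : GvRel GvV.b GvV.t
  | cv : GvRel GvV.c GvV.v
  | cs : GvRel GvV.c GvV.s
  | ct : GvRel GvV.c GvV.t

/-- The graph `G(v)`. -/
def Gv : SimpleGraph GvV := SimpleGraph.fromRel GvRel


/-! ## Layer 1: shape of a grid path with at most one bend -/

/-- The L-shape with end points `(a, b)` and `(c, d)` and corner `(a, d)`. -/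
def LS (a b c d i j : ℤ) : Prop :=
  (i = a ∧ ((b ≤ j ∧ j ≤ d) ∨ (d ≤ j ∧ j ≤ b))) ∨
  (j = d ∧ ((a ≤ i ∧ i ≤ c) ∨ (c ≤ i ∧ i ≤ a)))

theorem LS_swap (a b c d i j : ℤ) : LS a b c d i j ↔ LS d c b a j i := by
  unfold LS; omega

theorem straight_run (f : ℕ → ℤ × ℤ) (N : ℕ) (hs : ∀ i, i + 1 ≤ N → GridStep (f i) (f (i+1)))
    (hb : ∀ i, i + 2 ≤ N → (f i).1 = (f (i+2)).1 ∨ (f i).2 = (f (i+2)).2)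
    (hi : ∀ i, i + 2 ≤ N → f i ≠ f (i+2)) :
    ∃ s : ℤ, (s = 1 ∨ s = -1) ∧ ((∀ k : ℕ, k ≤ N → f k = ((f 0).1, (f 0).2 + k * s)) ∨
      (∀ k : ℕ, k ≤ N → f k = ((f 0).1 + k * s, (f 0).2))) := by
  have key : ∀ i, i + 2 ≤ N → (f (i+2)).1 - (f (i+1)).1 = (f (i+1)).1 - (f i).1 ∧
      (f (i+2)).2 - (f (i+1)).2 = (f (i+1)).2 - (f i).2 := by
    intro i h
    have h1 := hs i (by omega)
    have h2 := hs (i+1) (by omega)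
    have h3 := hb i h
    have h4 := hi i h
    rw [Ne, Prod.ext_iff] at h4
    unfold GridStep at h1 h2
    rw [show i + 1 + 1 = i + 2 from rfl] at h2
    omega
  have diff : ∀ i, i + 1 ≤ N → (f (i+1)).1 - (f i).1 = (f 1).1 - (f 0).1 ∧
      (f (i+1)).2 - (f i).2 = (f 1).2 - (f 0).2 := by
    intro i
    induction i with
    | zero => intro _; simp
    | succ k ih =>
      intro h
      have h1 := ih (by omega)
      have h2 := key k (by omega)
      rw [show k + 1 + 1 = k + 2 from rfl]
      omega
  have lin : ∀ i : ℕ, i ≤ N → (f i).1 = (f 0).1 + i * ((f 1).1 - (f 0).1) ∧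
      (f i).2 = (f 0).2 + i * ((f 1).2 - (f 0).2) := by
    intro i
    induction i with
    | zero => intro _; simp
    | succ k ih =>
      intro h
      have h1 := ih (by omega)
      have h2 := diff k (by omega)
      push_cast
      constructor <;> linarith
  rcases Nat.eq_zero_or_pos N with rfl | hN
  · refine ⟨1, Or.inl rfl, Or.inl ?_⟩
    intro k hk
    obtain rfl : k = 0 := by omega
    simp
  have h0 := hs 0 (by omega)
  unfold GridStep at h0
  simp only [zero_add] at h0
  have h5 : ((f 1).1 - (f 0).1 = 0 ∧ ((f 1).2 - (f 0).2 = 1 ∨ (f 1).2 - (f 0).2 = -1)) ∨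
      ((f 1).2 - (f 0).2 = 0 ∧ ((f 1).1 - (f 0).1 = 1 ∨ (f 1).1 - (f 0).1 = -1)) := by omega
  rcases h5 with ⟨h5, h6⟩ | ⟨h5, h6⟩
  · refine ⟨_, h6, Or.inl fun k hk => ?_⟩
    have := lin k hk
    rw [h5] at this
    ext
    · simpa using this.1
    · exact this.2
  · refine ⟨_, h6, Or.inr fun k hk => ?_⟩
    have := lin k hk
    rw [h5] at this
    ext
    · exact this.1
    · simpa using this.2

/-- vertical run of length `M`, then horizontal run -/
def VHrun (f : ℕ → ℤ × ℤ) (n M : ℕ) (s r : ℤ) : Prop :=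
  ∀ k : ℕ, k ≤ n → (k ≤ M → (f k).1 = (f 0).1 ∧ (f k).2 = (f 0).2 + k * s) ∧
    (M ≤ k → (f k).1 = (f 0).1 + (k - M) * r ∧ (f k).2 = (f 0).2 + M * s)

def HVrun (f : ℕ → ℤ × ℤ) (n M : ℕ) (s r : ℤ) : Prop :=
  ∀ k : ℕ, k ≤ n → (k ≤ M → (f k).2 = (f 0).2 ∧ (f k).1 = (f 0).1 + k * s) ∧
    (M ≤ k → (f k).2 = (f 0).2 + (k - M) * r ∧ (f k).1 = (f 0).1 + M * s)

theorem run_form (f : ℕ → ℤ × ℤ) (n : ℕ) (hs : ∀ i, i + 1 ≤ n → GridStep (f i) (f (i+1)))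
    (hinj : ∀ i j, i ≤ n → j ≤ n → f i = f j → i = j)
    (hb : ∀ i j, i + 2 ≤ n → j + 2 ≤ n → (f i).1 ≠ (f (i+2)).1 → (f i).2 ≠ (f (i+2)).2 →
      (f j).1 ≠ (f (j+2)).1 → (f j).2 ≠ (f (j+2)).2 → i = j) :
    ∃ M s r, M ≤ n ∧ (s = 1 ∨ s = -1) ∧ (r = 1 ∨ r = -1) ∧ (VHrun f n M s r ∨ HVrun f n M s r) := by
  by_cases hex : ∃ i, i + 2 ≤ n ∧ (f i).1 ≠ (f (i+2)).1 ∧ (f i).2 ≠ (f (i+2)).2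
  · obtain ⟨i, hin, b1, b2⟩ := hex
    obtain ⟨s, hs1, h1⟩ := straight_run f (i+1) (fun k hk => hs k (by omega))
      (fun k hk => by
        by_contra hcon
        push Not at hcon
        have := hb i k hin (by omega) b1 b2 hcon.1 hcon.2
        omega)
      (fun k hk he => by have := hinj k (k+2) (by omega) (by omega) he; omega)
    obtain ⟨r, hr1, h2⟩ := straight_run (fun k => f (i+1+k)) (n - (i+1)) 
      (fun k hk => hs (i+1+k) (by omega))
      (fun k hk => by
        by_contra hcon
        push Not at hcon
        have := hb i (i+1+k) hin (by omega) b1 b2 hcon.1 hcon.2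
        omega)
      (fun k hk he => by have := hinj (i+1+k) (i+1+(k+2)) (by omega) (by omega) he; omega)
    refine ⟨i+1, s, r, by omega, hs1, hr1, ?_⟩
    simp only [add_zero] at h2
    rcases h1 with h1 | h1
    · have e0 := h1 i (by omega)
      have e1 := h1 (i+1) le_rfl
      rcases h2 with h2 | h2
      · have e2 := h2 1 (by omega)
        rw [show i + 1 + 1 = i + 2 from rfl] at e2
        rw [e2, e0, e1] at b1
        simp at b1
      · left
        intro k hk
        refine ⟨fun hk' => by rw [h1 k hk']; simp, fun hk' => ?_⟩
        have := h2 (k - (i+1)) (by omega)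
        rw [show i + 1 + (k - (i+1)) = k by omega, e1] at this
        rw [this]
        push_cast [Nat.cast_sub hk']
        simp
    · have e0 := h1 i (by omega)
      have e1 := h1 (i+1) le_rfl
      rcases h2 with h2 | h2
      · right
        intro k hk
        refine ⟨fun hk' => by rw [h1 k hk']; simp, fun hk' => ?_⟩
        have := h2 (k - (i+1)) (by omega)
        rw [show i + 1 + (k - (i+1)) = k by omega, e1] at this
        rw [this]
        push_cast [Nat.cast_sub hk']
        simp
      · have e2 := h2 1 (by omega)
        rw [show i + 1 + 1 = i + 2 from rfl] at e2
        rw [e2, e0, e1] at b2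
        simp at b2
  · push Not at hex
    obtain ⟨s, hs1, h1⟩ := straight_run f n hs (fun k hk => by
        have := hex k hk
        tauto)
      (fun k hk he => by have := hinj k (k+2) (by omega) (by omega) he; omega)
    refine ⟨n, s, 1, le_rfl, hs1, Or.inl rfl, ?_⟩
    rcases h1 with h1 | h1
    · left
      intro k hk
      refine ⟨fun hk' => by rw [h1 k hk']; simp, fun hk' => ?_⟩
      obtain rfl : k = n := by omega
      rw [h1 k hk]; simp
    · right
      intro k hk
      refine ⟨fun hk' => by rw [h1 k hk']; simp, fun hk' => ?_⟩
      obtain rfl : k = n := by omega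
      rw [h1 k hk]; simp

theorem VH_set (f : ℕ → ℤ × ℤ) (n M : ℕ) (s r : ℤ) (hM : M ≤ n) (hs : s = 1 ∨ s = -1)
    (hr : r = 1 ∨ r = -1) (h : VHrun f n M s r) (i j : ℤ) :
    (∃ k, k ≤ n ∧ f k = (i, j)) ↔ LS (f 0).1 (f 0).2 (f n).1 (f n).2 i j := by
  have hn := (h n le_rfl).2 hM
  have h0 := h
  constructor
  · rintro ⟨k, hk, hk2⟩
    obtain ⟨h1, h2⟩ := h k hk
    rw [hk2] at h1 h2
    unfold LS
    dsimp only at h1 h2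
    rcases hs with rfl | rfl <;> rcases hr with rfl | rfl <;> omega
  · intro hL
    unfold LS at hL
    rcases hL with ⟨h1, h2⟩ | ⟨h1, h2⟩
    · have hk : (j - (f 0).2).natAbs ≤ M := by
        rcases hs with rfl | rfl <;> omega
      refine ⟨(j - (f 0).2).natAbs, by omega, ?_⟩
      have := (h (j - (f 0).2).natAbs (by omega)).1 hk
      ext
      · omega
      · rcases hs with rfl | rfl <;> omega
    · have hk : M + (i - (f 0).1).natAbs ≤ n := by
        rcases hr with rfl | rfl <;> omega
      refine ⟨M + (i - (f 0).1).natAbs, hk, ?_⟩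
      have := (h (M + (i - (f 0).1).natAbs) hk).2 (by omega)
      ext
      · rcases hr with rfl | rfl <;> omega
      · omega

theorem VH_consec (f : ℕ → ℤ × ℤ) (n M : ℕ) (s r : ℤ) (hs : s = 1 ∨ s = -1)
    (hr : r = 1 ∨ r = -1) (h : VHrun f n M s r) (k l : ℕ) (hk : k ≤ n) (hl : l ≤ n)
    (hst : GridStep (f k) (f l)) : k + 1 = l ∨ l + 1 = k := by
  obtain ⟨h1, h2⟩ := h k hk
  obtain ⟨h3, h4⟩ := h l hl
  unfold GridStep at hst
  rcases hs with rfl | rfl <;> rcases hr with rfl | rfl <;> 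
    rcases le_total k M with a | a <;> rcases le_total l M with b | b <;>
    simp only [a, b, true_imp_iff] at h1 h2 h3 h4 <;> omega

theorem HV_swap (f : ℕ → ℤ × ℤ) (n M : ℕ) (s r : ℤ) (h : HVrun f n M s r) :
    VHrun (fun k => (f k).swap) n M s r := h

theorem infix_take {α : Type} (l : List α) (k m : ℕ) : (l.drop k).take m <:+: l :=
  ((l.drop k).take_prefix m).isInfix.trans (l.drop_suffix k).isInfix

theorem path_shape (P : GridPath) (hP : P.BendsAtMost 1) :
    ∃ a b c d : ℤ, (((a, b) = P.first ∧ (c, d) = P.last) ∨ ((a, b) = P.last ∧ (c, d) = P.first)) ∧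
      (a, b) ≠ (c, d) ∧
      (∀ i j, (i, j) ∈ P.toSet ↔ LS a b c d i j) ∧
      (∀ p q, p ∈ P.toSet → q ∈ P.toSet → GridStep p q → ConsecIn P.pts p q) := by
  have hlen := P.two_le_length
  set l := P.pts with hl
  obtain ⟨n, hn⟩ : ∃ n, l.length = n + 1 := ⟨l.length - 1, by omega⟩
  let f : ℕ → ℤ × ℤ := fun k => l.getD k (0, 0)
  have hf : ∀ k (hk : k < l.length), f k = l[k] := fun k hk => by simp [f, hk]
  have hsteps : ∀ i, i + 1 ≤ n → GridStep (f i) (f (i+1)) := by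
    intro i hi
    have := P.step
    rw [hf i (by omega), hf (i+1) (by omega)]
    exact List.isChain_iff_getElem.1 this i (by rw [← hl]; omega)
  have hinj : ∀ i j, i ≤ n → j ≤ n → f i = f j → i = j := by
    intro i j hi hj he
    rw [hf i (by omega), hf j (by omega)] at he
    exact (P.nodup.getElem_inj_iff).1 he
  have hbend : ∀ i, i + 2 ≤ n → (f i).1 ≠ (f (i+2)).1 → (f i).2 ≠ (f (i+2)).2 → f (i+1) ∈ P.bendSet := by
    intro i hi h1 h2
    refine ⟨f i, f (i+2), ?_, h1, h2⟩
    have := infix_take l i 3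
    rw [List.drop_eq_getElem_cons (by omega), List.drop_eq_getElem_cons (by omega),
      List.drop_eq_getElem_cons (by omega)] at this
    rw [hf i (by omega), hf (i+1) (by omega), hf (i+2) (by omega)]
    exact this
  have hfin : P.bendSet.Finite := by
    refine Set.Finite.subset (List.finite_toSet l) ?_
    rintro p ⟨a, c, h, -⟩
    exact h.subset (by simp)
  have hb : ∀ i j, i + 2 ≤ n → j + 2 ≤ n → (f i).1 ≠ (f (i+2)).1 → (f i).2 ≠ (f (i+2)).2 →
      (f j).1 ≠ (f (j+2)).1 → (f j).2 ≠ (f (j+2)).2 → i = j := by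
    intro i j hi hj h1 h2 h3 h4
    have := (Set.ncard_le_one hfin).1 hP _ (hbend i hi h1 h2) _ (hbend j hj h3 h4)
    have := hinj _ _ (by omega) (by omega) this
    omega
  have hfirst : P.first = f 0 := by
    rw [hf 0 (by omega)]
    unfold GridPath.first
    rw [List.head_eq_getElem]
  have hlast : P.last = f n := by
    rw [hf n (by omega)]
    unfold GridPath.last
    rw [List.getLast_eq_getElem]
    congr 1
    rw [← hl]; omega
  have hmem : ∀ p, p ∈ P.toSet ↔ ∃ k, k ≤ n ∧ f k = p := by
    intro p
    show p ∈ l ↔ _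
    rw [List.mem_iff_getElem]
    constructor
    · rintro ⟨k, hk, rfl⟩
      exact ⟨k, by omega, hf k hk⟩
    · rintro ⟨k, hk, rfl⟩
      exact ⟨k, by omega, (hf k (by omega)).symm⟩
  have hcons : ∀ k, k + 1 ≤ n → [f k, f (k+1)] <:+: l := by
    intro i hi
    have := infix_take l i 2
    rw [List.drop_eq_getElem_cons (by omega), List.drop_eq_getElem_cons (by omega)] at this
    rw [hf i (by omega), hf (i+1) (by omega)]
    exact this
  have hne : f 0 ≠ f n := fun he => by have := hinj 0 n (by omega) le_rfl he; omega
  obtain ⟨M, s, r, hM, hs1, hr1, hrun⟩ := run_form f n hsteps hinj hb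
  have hfinal : ∀ p q, p ∈ P.toSet → q ∈ P.toSet → GridStep p q → ConsecIn l p q := by
    intro p q hp hq hpq
    rw [hmem] at hp hq
    obtain ⟨k, hk, rfl⟩ := hp
    obtain ⟨k', hk', rfl⟩ := hq
    have : k + 1 = k' ∨ k' + 1 = k := by
      rcases hrun with hrun | hrun
      · exact VH_consec f n M s r hs1 hr1 hrun k k' hk hk' hpq
      · refine VH_consec _ n M s r hs1 hr1 (HV_swap f n M s r hrun) k k' hk hk' ?_
        unfold GridStep at hpq ⊢
        simp only [Prod.fst_swap, Prod.snd_swap]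
        omega
    rcases this with rfl | rfl
    · exact Or.inl (hcons k hk')
    · exact Or.inr (hcons k' hk)
  rcases hrun with hrun | hrun
  · refine ⟨(f 0).1, (f 0).2, (f n).1, (f n).2, Or.inl ⟨hfirst.symm, hlast.symm⟩, hne, ?_, hfinal⟩
    intro i j
    rw [hmem]
    exact VH_set f n M s r hM hs1 hr1 hrun i j
  · refine ⟨(f n).1, (f n).2, (f 0).1, (f 0).2, Or.inr ⟨hlast.symm, hfirst.symm⟩, hne.symm, ?_, hfinal⟩
    intro i j
    rw [hmem]
    have := VH_set _ n M s r hM hs1 hr1 (HV_swap f n M s r hrun) j i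
    have h2 : (∃ k, k ≤ n ∧ f k = (i, j)) ↔ (∃ k, k ≤ n ∧ (f k).swap = (j, i)) := by
      refine exists_congr fun k => and_congr_right fun _ => ?_
      rw [Prod.ext_iff, Prod.ext_iff]
      simp only [Prod.fst_swap, Prod.snd_swap]
      tauto
    rw [h2, this]
    simp only [Prod.fst_swap, Prod.snd_swap]
    exact LS_swap _ _ _ _ _ _


/-! ## Layer 3: the combinatorial core, in normalized coordinates -/

/-- An L-shape leaving `(x, 0)` vertically up to height `h`, then horizontally to `(m, h)`. -/
def Vset (x h m i j : ℤ) : Prop :=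
  (i = x ∧ ((0 ≤ j ∧ j ≤ h) ∨ (h ≤ j ∧ j ≤ 0))) ∨
  (j = h ∧ ((x ≤ i ∧ i ≤ m) ∨ (m ≤ i ∧ i ≤ x)))

def Onv (X Y i j : ℤ) : Prop := (j = 0 ∧ 0 ≤ i ∧ i ≤ X) ∨ (i = 0 ∧ 0 ≤ j ∧ j ≤ Y)

structure Conf (ι : Type) where
  X : ℤ
  Y : ℤ
  V : ι → Prop
  x : ι → ℤ
  h : ι → ℤ
  m : ι → ℤ
  S : ι → ℤ → ℤ → Prop
  ei : ι → ℤ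
  ej : ι → ℤ
  hX : 0 ≤ X
  hY : 0 ≤ Y
  h0 : ∀ u, h u ≠ 0
  x0 : ∀ u, 0 ≤ x u
  shV : ∀ u, V u → (∀ i j, S u i j ↔ Vset (x u) (h u) (m u) i j) ∧ ei u = m u ∧ ej u = h u ∧ x u < X
  shH : ∀ u, ¬ V u → (∀ i j, S u i j ↔ Vset (x u) (h u) (m u) j i) ∧ ej u = m u ∧ ei u = h u ∧ x u < Y
  cor : ∀ u, x u = 0 → h u < 0
  vd : ∀ u i j, S u i j → Onv X Y i j →
    ((V u ∧ i = x u ∧ j = 0) ∨ (¬ V u ∧ j = x u ∧ i = 0) ∨ (i = ei u ∧ j = ej u)) ∧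
    (i = 0 → j < Y) ∧ (j = 0 → i < X)
  disj : ∀ u w, u ≠ w → ∀ i j, S u i j → S w i j → Onv X Y i j ∨
    (i = ei u ∧ j = ej u) ∨ (i = ei w ∧ j = ej w)
  segh : ∀ u w, u ≠ w → ∀ i j, S u i j → S u (i+1) j → S w i j → S w (i+1) j → False
  segv : ∀ u w, u ≠ w → ∀ i j, S u i j → S u i (j+1) → S w i j → S w i (j+1) → False

namespace Conf
variable {ι : Type} (C : Conf ι)

def swap : Conf ι where
  X := C.Y
  Y := C.X
  V := fun u => ¬ C.V u
  x := C.x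
  h := C.h
  m := C.m
  S := fun u i j => C.S u j i
  ei := C.ej
  ej := C.ei
  hX := C.hY
  hY := C.hX
  h0 := C.h0
  x0 := C.x0
  shV := fun u hu => by
    have := C.shH u hu
    exact ⟨fun i j => this.1 j i, this.2⟩
  shH := fun u hu => by
    have := C.shV u (not_not.mp hu)
    exact ⟨fun i j => this.1 j i, this.2⟩
  cor := C.cor
  vd := fun u i j hs ho => by
    have := C.vd u j i hs (by unfold Onv at *; tauto)
    tauto
  disj := fun u w hne i j h1 h2 => by
    have := C.disj u w hne j i h1 h2
    unfold Onv at *; tauto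
  segh := fun u w hne i j => C.segv u w hne j i
  segv := fun u w hne i j => C.segh u w hne j i

def on (i j : ℤ) : Prop := Onv C.X C.Y i j
def E (u w : ι) : Prop := C.S w (C.ei u) (C.ej u)
def Con (u w : ι) : Prop := ∃ i j, C.S u i j ∧ C.S w i j

theorem e_mem (u : ι) : C.S u (C.ei u) (C.ej u) := by
  by_cases hv : C.V u
  · obtain ⟨h1, h2, h3, h4⟩ := C.shV u hv
    rw [h1, h2, h3]; unfold Vset; omega
  · obtain ⟨h1, h2, h3, h4⟩ := C.shH u hv
    rw [h1, h2, h3]; unfold Vset; omega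

/-- points of an inside path on `v` -/
theorem in1 {u i j} (hu : 0 < C.h u) (h1 : C.S u i j) (h2 : C.on i j) :
    (j = 0 ∧ 0 < i ∧ C.S u i 0 ∧ C.S u i (0+1)) ∨ (i = 0 ∧ 0 < j ∧ C.S u 0 j ∧ C.S u (0+1) j) := by
  have hvd := C.vd u i j h1 h2
  have hc := C.cor u
  have hx := C.x0 u
  unfold on Onv at h2
  by_cases hv : C.V u
  · obtain ⟨h3, h4, h5, h6⟩ := C.shV u hv
    simp only [h3, h4, h5, hv, true_and, not_true, false_and, false_or] at *
    unfold Vset at *; omega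
  · obtain ⟨h3, h4, h5, h6⟩ := C.shH u hv
    simp only [h3, h4, h5, hv, true_and, not_false_eq_true, false_and, false_or] at *
    unfold Vset at *; omega

theorem inn {u w i j} (hne : u ≠ w) (hu : 0 < C.h u) (hw : 0 < C.h w)
    (h1 : C.S u i j) (h3 : C.S w i j) (h2 : C.on i j) : False := by
  have a1 := C.in1 hu h1 h2
  have a2 := C.in1 hw h3 h2
  rcases a1 with ⟨rfl, b1, b2, b3⟩ | ⟨rfl, b1, b2, b3⟩
  · rcases a2 with ⟨_, c1, c2, c3⟩ | ⟨_, c1, c2, c3⟩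
    · exact C.segv u w hne _ _ b2 b3 c2 c3
    · omega
  · rcases a2 with ⟨_, c1, c2, c3⟩ | ⟨_, c1, c2, c3⟩
    · omega
    · exact C.segh u w hne _ _ b2 b3 c2 c3

theorem in2 {u j j'} (hu : 0 < C.h u) (h1 : C.S u 0 j) (h2 : C.on 0 j) 
    (h3 : C.S u 0 j') (h4 : C.on 0 j') : j = j' := by
  have hvd := C.vd u 0 j h1 h2
  have hvd' := C.vd u 0 j' h3 h4
  have hc := C.cor u
  have hx := C.x0 u
  unfold on Onv at h2 h4
  by_cases hv : C.V u
  · obtain ⟨h3, h4, h5, h6⟩ := C.shV u hv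
    simp only [h3, h4, h5, hv, true_and, not_true, false_and, false_or] at *
    unfold Vset at *; omega
  · obtain ⟨h3, h4, h5, h6⟩ := C.shH u hv
    simp only [h3, h4, h5, hv, true_and, not_false_eq_true, false_and, false_or] at *
    unfold Vset at *; omega

theorem in2' {u i i'} (hu : 0 < C.h u) (h1 : C.S u i 0) (h2 : C.on i 0) 
    (h3 : C.S u i' 0) (h4 : C.on i' 0) : i = i' := by
  refine C.swap.in2 (u := u) hu h1 ?_ h3 ?_ <;> (unfold on Onv swap at *; dsimp only; omega)

/-- a path whose end is strictly left of `v`'s vertical arm, inside vertical type, avoids the arm. -/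
theorem noarm {u j} (hv : C.V u) (hu : 0 < C.h u) (he : C.ei u < 0) (h1 : C.S u 0 j) (h2 : C.on 0 j) : 
    False := by
  have hvd := C.vd u 0 j h1 h2
  have hc := C.cor u
  have hx := C.x0 u
  unfold on Onv at h2
  obtain ⟨h3, h4, h5, h6⟩ := C.shV u hv
  simp only [h3, h4, h5, hv, true_and, not_true, false_and, false_or] at *
  unfold Vset at *; omega

theorem outV {u i j} (hu : C.h u < 0) (hv : C.V u) (h1 : C.S u i j) (h2 : C.on i j) :
    j = 0 ∧ C.S u i (-1) ∧ C.S u i (-1+1) := by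
  have hx := C.x0 u
  unfold on Onv at h2
  have a3 := (C.shV u hv).1
  simp only [a3] at *
  unfold Vset at *; omega

theorem outVV {u w i j} (hne : u ≠ w) (hu : C.h u < 0) (hw : C.h w < 0) (ht : C.V u) (ht' : C.V w)
    (h1 : C.S u i j) (h3 : C.S w i j) (h2 : C.on i j) : False := by
  have a := C.outV hu ht h1 h2
  have b := C.outV hw ht' h3 h2
  exact C.segv u w hne _ _ a.2.1 a.2.2 b.2.1 b.2.2

theorem out2 {u w i j} (hne : u ≠ w) (hu : C.h u < 0) (hw : C.h w < 0) (ht : C.V u ↔ C.V w)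
    (h1 : C.S u i j) (h3 : C.S w i j) (h2 : C.on i j) : False := by
  by_cases hv : C.V u
  · exact C.outVV hne hu hw hv (ht.1 hv) h1 h3 h2
  · refine C.swap.outVV (u := u) (w := w) hne hu hw hv (fun q => hv (ht.2 q)) h1 h3 ?_
    unfold on Onv swap at *; dsimp only; omega

theorem out3 {u w i j} (hu : C.h u < 0) (hw : C.h w < 0) (ht : C.V u) (ht' : ¬ C.V w)
    (h1 : C.S u i j) (h3 : C.S w i j) : 
    (i = 0 ∧ j = 0) ∨ (i < 0 ∧ j < 0 ∧ C.ei u < 0 ∧ C.ej w < 0) := by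
  have hx := C.x0 u
  have hx' := C.x0 w
  obtain ⟨a3, a4, a5, a6⟩ := C.shV u ht
  obtain ⟨b3, b4, b5, b6⟩ := C.shH w ht'
  simp only [a3, a4, a5, b3, b4, b5] at *
  unfold Vset at *; omega

theorem hookV {u w i j} (hne : u ≠ w) (hu : C.V u) (hw : C.V w) 
    (h1 : C.S u i j) (h3 : C.S w i j) (hi : i < 0) : False := by
  have hx := C.x0 u
  have hx' := C.x0 w
  obtain ⟨a3, a4, a5, a6⟩ := C.shV u hu
  obtain ⟨b3, b4, b5, b6⟩ := C.shV w hw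
  have hs := C.segh u w hne (-1) j
  simp only [a3, a4, a5, b3, b4, b5] at *
  unfold Vset at *; exact hs (by omega) (by omega) (by omega) (by omega)

theorem hookH {u w i j} (hne : u ≠ w) (hu : ¬ C.V u) (hw : ¬ C.V w) 
    (h1 : C.S u i j) (h3 : C.S w i j) (hi : j < 0) : False :=
  C.swap.hookV (u := u) (w := w) hne hu hw h1 h3 hi

theorem hookH' {u w i j} (hne : u ≠ w) (hu : ¬ C.V u) (hw : ¬ C.V w) 
    (h1 : C.S u i j) (h3 : C.S w i j) (hi : C.Y < j) : False := by
  have hx := C.x0 u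
  have hx' := C.x0 w
  obtain ⟨a3, a4, a5, a6⟩ := C.shH u hu
  obtain ⟨b3, b4, b5, b6⟩ := C.shH w hw
  have hs := C.segv u w hne i C.Y
  simp only [a3, a4, a5, b3, b4, b5] at *
  unfold Vset at *; exact hs (by omega) (by omega) (by omega) (by omega)

/-- The end of an inside vertical path that lies left of the arm is on no other inside path. -/
theorem hookIn {u w} (hne : u ≠ w) (hu : C.V u) (he : C.ei u < 0) (hw : 0 < C.h w) :
    ¬ C.E u w := by
  intro hE
  by_cases hv : C.V w
  · exact C.hookV hne hu hv (C.e_mem u) hE he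
  · obtain ⟨b3, b4, b5, b6⟩ := C.shH w hv
    unfold E at hE
    rw [b3] at hE
    unfold Vset at *; omega

theorem cAB {u w i j} (hu : C.V u) (hw : C.V w) (h1 : 0 < C.h u) (h2 : C.h w < 0)
    (h3 : C.S u i j) (h4 : C.S w i j) : i = C.x w ∧ j = 0 := by
  obtain ⟨a3, a4, a5, a6⟩ := C.shV u hu
  obtain ⟨b3, b4, b5, b6⟩ := C.shV w hw
  rw [a3] at h3
  rw [b3] at h4
  unfold Vset at *; omega

theorem cCD {u w i j} (hu : ¬ C.V u) (hw : ¬ C.V w) (h1 : 0 < C.h u) (h2 : C.h w < 0)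
    (h3 : C.S u i j) (h4 : C.S w i j) : i = 0 ∧ j = C.x w :=
  (C.swap.cAB (u := u) (w := w) hu hw h1 h2 h3 h4).symm

theorem cAD {u w i j} (hu : C.V u) (hw : ¬ C.V w) (h1 : 0 < C.h u) (h2 : C.h w < 0)
    (h3 : C.S u i j) (h4 : C.S w i j) : (i = 0 ∧ j = C.x w) ∨ 
      (C.ei u < 0 ∧ C.Y < C.ej u ∧ C.ei w < 0 ∧ C.Y < C.ej w) := by
  have hvd := C.vd u 0 j
  have hx := C.x0 u
  have hx' := C.x0 w
  have hc := C.cor u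
  obtain ⟨a3, a4, a5, a6⟩ := C.shV u hu
  obtain ⟨b3, b4, b5, b6⟩ := C.shH w hw
  simp only [a3, a4, a5, b3, b4, b5, hu, true_and, not_true, false_and, false_or] at *
  unfold Vset Onv at *; omega

theorem anchV {u} (hu : C.V u) : C.on (C.x u) 0 ∧ C.S u (C.x u) 0 := by
  obtain ⟨a3, a4, a5, a6⟩ := C.shV u hu
  have := C.x0 u
  rw [a3]
  unfold on Onv Vset; omega

theorem anchH {u} (hu : ¬ C.V u) : C.on 0 (C.x u) ∧ C.S u 0 (C.x u) := by
  obtain ⟨a3, a4, a5, a6⟩ := C.shH u hu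
  have := C.x0 u
  rw [a3]
  unfold on Onv Vset; omega

theorem con_off {u w} (hne : u ≠ w) (hc : C.Con u w)
    (hoff : ∀ i j, C.S u i j → C.S w i j → ¬ C.on i j) : C.E u w ∨ C.E w u := by
  obtain ⟨i, j, h1, h2⟩ := hc
  rcases C.disj u w hne i j h1 h2 with h | ⟨rfl, rfl⟩ | ⟨rfl, rfl⟩
  · exact absurd h (hoff i j h1 h2)
  · exact Or.inl h2
  · exact Or.inr h1

end Conf


/-- `K_{2,3}`-like contact data: `s, t` and three pairwise non-touching middle paths. -/
structure Gra {ι : Type} (C : Conf ι) (s t : ι) (M : ι → Prop) : Prop where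
  st : s ≠ t
  cst : C.Con s t
  ms : ∀ x, M x → x ≠ s ∧ C.Con x s
  mt : ∀ x, M x → x ≠ t ∧ C.Con x t
  mm : ∀ x y, M x → M y → x ≠ y → ¬ C.Con x y
  three : ∃ a b c, M a ∧ M b ∧ M c ∧ a ≠ b ∧ a ≠ c ∧ b ≠ c

namespace Gra
variable {ι : Type} {C : Conf ι} {s t : ι} {M : ι → Prop}

theorem symm (G : Gra C s t M) : Gra C t s M where
  st := G.st.symm
  cst := by obtain ⟨i, j, h1, h2⟩ := G.cst; exact ⟨i, j, h2, h1⟩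
  ms := G.mt
  mt := G.ms
  mm := G.mm
  three := G.three

theorem swap (G : Gra C s t M) : Gra C.swap s t M where
  st := G.st
  cst := by obtain ⟨i, j, h1, h2⟩ := G.cst; exact ⟨j, i, h1, h2⟩
  ms := fun x hx => by obtain ⟨h, i, j, h1, h2⟩ := G.ms x hx; exact ⟨h, j, i, h1, h2⟩
  mt := fun x hx => by obtain ⟨h, i, j, h1, h2⟩ := G.mt x hx; exact ⟨h, j, i, h1, h2⟩
  mm := fun x y hx hy hne ⟨i, j, h1, h2⟩ => G.mm x y hx hy hne ⟨j, i, h1, h2⟩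
  three := G.three

theorem two (G : Gra C s t M) (Q : ι → Prop) (hQ : ∀ x y, M x → M y → Q x → Q y → x = y) :
    ∃ x y, M x ∧ M y ∧ x ≠ y ∧ ¬ Q x ∧ ¬ Q y := by
  obtain ⟨a, b, c, ha, hb, hc, h1, h2, h3⟩ := G.three
  by_cases qa : Q a
  · exact ⟨b, c, hb, hc, h3, fun q => h1 (hQ a b ha hb qa q), fun q => h2 (hQ a c ha hc qa q)⟩
  · by_cases qb : Q b
    · exact ⟨a, c, ha, hc, h2, qa, fun q => h3 (hQ b c hb hc qb q)⟩
    · exact ⟨a, b, ha, hb, h1, qa, qb⟩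

theorem mm' (G : Gra C s t M) {x y i j} (hx : M x) (hy : M y) (h1 : C.S x i j) (h2 : C.S y i j) :
    x = y := by
  by_contra hne
  exact G.mm x y hx hy hne ⟨i, j, h1, h2⟩

/-- Two outer paths, two middle paths, all touching at free ends, and no triple point. -/
theorem k4 (G : Gra C s t M) {y z} (hy : M y) (hz : M z) (hne : y ≠ z)
    (est : C.E s t ∨ C.E t s)
    (eys : C.E y s ∨ C.E s y) (eyt : C.E y t ∨ C.E t y)
    (ezs : C.E z s ∨ C.E s z) (ezt : C.E z t ∨ C.E t z)
    (hy3 : ∀ i j, C.S s i j → C.S t i j → C.S y i j → False)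
    (hz3 : ∀ i j, C.S s i j → C.S t i j → C.S z i j → False) : False := by
  have n1 : ¬ (C.E s y ∧ C.E s z) := fun h => hne (G.mm' hy hz h.1 h.2)
  have n2 : ¬ (C.E t y ∧ C.E t z) := fun h => hne (G.mm' hy hz h.1 h.2)
  have n3 : ¬ (C.E y s ∧ C.E y t) := fun h => hy3 _ _ h.1 h.2 (C.e_mem y)
  have n4 : ¬ (C.E z s ∧ C.E z t) := fun h => hz3 _ _ h.1 h.2 (C.e_mem z)
  have n5 : ¬ (C.E s t ∧ C.E s y) := fun h => hy3 _ _ (C.e_mem s) h.1 h.2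
  have n6 : ¬ (C.E s t ∧ C.E s z) := fun h => hz3 _ _ (C.e_mem s) h.1 h.2
  have n7 : ¬ (C.E t s ∧ C.E t y) := fun h => hy3 _ _ h.1 (C.e_mem t) h.2
  have n8 : ¬ (C.E t s ∧ C.E t z) := fun h => hz3 _ _ h.1 (C.e_mem t) h.2
  clear hy3 hz3
  grind only

/-- `K_{2,3}` cannot be realized with all contacts at free ends. -/
theorem k5 (G : Gra C s t M)
    (es : ∀ x, M x → C.E x s ∨ C.E s x) (et : ∀ x, M x → C.E x t ∨ C.E t x)
    (off : ∀ x, M x → C.E x s → C.E x t → ¬ C.on (C.ei x) (C.ej x)) : False := by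
  have key : ∀ x, M x → C.E x s → C.E x t → C.E s x ∨ C.E t x := by
    intro x hx h1 h2
    rcases C.disj s t G.st _ _ h1 h2 with h | ⟨h, h'⟩ | ⟨h, h'⟩
    · exact absurd h (off x hx h1 h2)
    · left; unfold Conf.E; rw [← h, ← h']; exact C.e_mem x
    · right; unfold Conf.E; rw [← h, ← h']; exact C.e_mem x
  have key' : ∀ x, M x → C.E s x ∨ C.E t x := by
    intro x hx
    have := es x hx
    have := et x hx
    have := key x hx
    tauto
  obtain ⟨x, y, hx, hy, hne, h1, h2⟩ := G.two (fun x => C.E s x)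
    (fun x y hx hy h1 h2 => G.mm' hx hy h1 h2)
  exact hne (G.mm' hx hy ((key' x hx).resolve_left h1) ((key' y hy).resolve_left h2))

/-- no contact beyond the end of the horizontal arm -/
def NoBC (C : Conf ι) : Prop := ∀ u w i j, C.V u → ¬ C.V w → C.h u < 0 → 0 < C.h w →
  C.S u i j → C.S w i j → i = C.x u ∧ j = 0

theorem cB (nb : NoBC C) {u w i j} (hu : C.V u) (h1 : C.h u < 0) (h2 : 0 < C.h w)
    (h3 : C.S u i j) (h4 : C.S w i j) : C.S w (C.x u) 0 := by
  by_cases hw : C.V w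
  · obtain ⟨rfl, rfl⟩ := C.cAB hw hu h2 h1 h4 h3
    exact h4
  · obtain ⟨rfl, rfl⟩ := nb u w i j hu hw h1 h2 h3 h4
    exact h4

theorem cD {u w i j} (hu : ¬ C.V u) (h1 : C.h u < 0) (h2 : 0 < C.h w)
    (h3 : C.S u i j) (h4 : C.S w i j) : C.S w 0 (C.x u) ∨ 
      (C.V w ∧ C.ei w < 0 ∧ C.Y < C.ej w ∧ C.ei u < 0 ∧ C.Y < C.ej u) := by
  by_cases hw : C.V w
  · rcases C.cAD hw hu h2 h1 h4 h3 with ⟨rfl, rfl⟩ | h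
    · exact Or.inl h4
    · exact Or.inr ⟨hw, h⟩
  · obtain ⟨rfl, rfl⟩ := C.cCD hw hu h2 h1 h4 h3
    exact Or.inl h4

theorem AA {u w} (hne : u ≠ w) (hu : C.V u) (hw : C.V w) (h1 : 0 < C.h u) (h2 : 0 < C.h w)
    (h3 : C.ei u < 0) (h4 : C.ei w < 0) (hc : C.Con u w) : False := by
  rcases C.con_off hne hc (fun i j a b c => C.inn hne h1 h2 a b c) with h | h
  · exact C.hookIn hne hu h3 h2 h
  · exact C.hookIn hne.symm hw h4 h1 h

theorem DD {u w} (hne : u ≠ w) (hu : ¬ C.V u) (hw : ¬ C.V w) (h1 : C.h u < 0) (h2 : C.h w < 0)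
    (h3 : C.Y < C.ej u) (h4 : C.Y < C.ej w) (hc : C.Con u w) : False := by
  rcases C.con_off hne hc (fun i j a b c => C.out2 hne h1 h2 (by tauto) a b c) with h | h
  · exact C.hookH' hne hu hw (C.e_mem u) h h3
  · exact C.hookH' hne hu hw h (C.e_mem w) h4

theorem Con.symm' {u w} (h : C.Con u w) : C.Con w u := by
  obtain ⟨i, j, h1, h2⟩ := h; exact ⟨i, j, h2, h1⟩

theorem no0 {u} (hu : 0 < C.h u) (h : C.S u 0 0) : False := by
  have := C.in1 hu h (by have := C.hX; have := C.hY; unfold Conf.on Onv; omega)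
  omega

theorem inout (C : Conf ι) (u : ι) : 0 < C.h u ∨ C.h u < 0 := by have := C.h0 u; omega

/-- all inside -/
theorem all_in (G : Gra C s t M) (hs : 0 < C.h s) (ht : 0 < C.h t) (hM : ∀ x, M x → 0 < C.h x) :
    False := by
  refine G.k5 ?_ ?_ ?_
  · intro x hx
    exact C.con_off (G.ms x hx).1 (G.ms x hx).2 (fun i j a b c => C.inn (G.ms x hx).1 (hM x hx) hs a b c)
  · intro x hx
    exact C.con_off (G.mt x hx).1 (G.mt x hx).2 (fun i j a b c => C.inn (G.mt x hx).1 (hM x hx) ht a b c)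
  · intro x hx h1 h2 h3
    exact C.inn G.st hs ht h1 h2 h3

/-- `s` meets the outside path `x` on the vertical arm, `t` passes over the arm. -/
theorem in_in_aux (G : Gra C s t M) (hs : 0 < C.h s) (ht : 0 < C.h t) 
    (hV : C.V t) (he : C.ei t < 0) {x : ι}
    (honly : ∀ y, M y → C.h y < 0 → y = x) : False := by
  obtain ⟨y, z, hy, hz, hyz, ny, nz⟩ := G.two (fun y => y = x) (fun _ _ _ _ h h' => h.trans h'.symm)
  have n1 : ¬ C.E t s := C.hookIn G.st.symm hV he hs
  have e1 : C.E s t := (C.con_off G.st G.cst (fun i j a b c => C.inn G.st hs ht a b c)).resolve_right n1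
  have key : ∀ y, M y → ¬ y = x → C.E s y := by
    intro y hy ny
    have iy : 0 < C.h y := (inout C y).resolve_right (fun h => ny (honly y hy h))
    obtain ⟨y1, y2⟩ := G.ms y hy
    obtain ⟨y3, y4⟩ := G.mt y hy
    have e2 : C.E y t := (C.con_off y3 y4 (fun i j a b c => C.inn y3 iy ht a b c)).resolve_right 
      (C.hookIn y3.symm hV he iy)
    rcases C.con_off y1 y2 (fun i j a b c => C.inn y1 iy hs a b c) with h | h
    · rcases C.disj s t G.st _ _ h e2 with h' | ⟨h', h''⟩ | ⟨h', h''⟩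
      · exact (C.inn G.st hs ht h e2 h').elim
      · unfold Conf.E; rw [← h', ← h'']; exact C.e_mem y
      · unfold Conf.E at h n1; rw [h', h''] at h; exact (n1 h).elim
    · exact h
  exact hyz (G.mm' hy hz (key y hy ny) (key z hz nz))

theorem in_in (G : Gra C s t M) (nb : NoBC C) (hs : 0 < C.h s) (ht : 0 < C.h t) : False := by
  by_cases hall : ∀ x, M x → 0 < C.h x
  · exact G.all_in hs ht hall
  push Not at hall
  have outs : ∀ x, M x → C.h x < 0 → ¬ C.V x := by
    intro x hx ox hv
    obtain ⟨_, i, j, a1, a2⟩ := G.ms x hx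
    obtain ⟨_, i', j', b1, b2⟩ := G.mt x hx
    exact C.inn G.st hs ht (cB nb hv ox hs a1 a2) (cB nb hv ox ht b1 b2) (C.anchV hv).1
  have cases : ∀ x, M x → C.h x < 0 → (C.S s 0 (C.x x) ∧ C.V t ∧ C.ei t < 0) ∨
      (C.S t 0 (C.x x) ∧ C.V s ∧ C.ei s < 0) := by
    intro x hx ox
    have hv := outs x hx ox
    obtain ⟨_, i, j, a1, a2⟩ := G.ms x hx
    obtain ⟨_, i', j', b1, b2⟩ := G.mt x hx
    rcases cD hv ox hs a1 a2 with h | h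
    · rcases cD hv ox ht b1 b2 with h' | h'
      · exact (C.inn G.st hs ht h h' (C.anchH hv).1).elim
      · exact Or.inl ⟨h, h'.1, h'.2.1⟩
    · rcases cD hv ox ht b1 b2 with h' | h'
      · exact Or.inr ⟨h', h.1, h.2.1⟩
      · exact (AA G.st h.1 h'.1 hs ht h.2.1 h'.2.1 G.cst).elim
  have bad : ∀ u k, 0 < C.h u → C.V u → C.ei u < 0 → C.S u 0 k → C.on 0 k → False :=
    fun u k h1 h2 h3 h4 h5 => C.noarm h2 h1 h3 h4 h5
  obtain ⟨x, hx, ox⟩ := hall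
  have ox : C.h x < 0 := by have := C.h0 x; omega
  rcases cases x hx ox with h | h
  · refine G.in_in_aux hs ht h.2.1 h.2.2 (x := x) ?_
    intro y hy oy
    rcases cases y hy oy with h' | h'
    · have := C.in2 hs h.1 (C.anchH (outs x hx ox)).1 h'.1 (C.anchH (outs y hy oy)).1
      refine G.mm' hy hx (C.anchH (outs y hy oy)).2 ?_
      rw [← this]; exact (C.anchH (outs x hx ox)).2
    · exact (bad s _ hs h'.2.1 h'.2.2 h.1 (C.anchH (outs x hx ox)).1).elim
  · refine G.symm.in_in_aux ht hs h.2.1 h.2.2 (x := x) ?_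
    intro y hy oy
    rcases cases y hy oy with h' | h'
    · exact (bad t _ ht h'.2.1 h'.2.2 h.1 (C.anchH (outs x hx ox)).1).elim
    · have := C.in2 ht h.1 (C.anchH (outs x hx ox)).1 h'.1 (C.anchH (outs y hy oy)).1
      refine G.mm' hy hx (C.anchH (outs y hy oy)).2 ?_
      rw [← this]; exact (C.anchH (outs x hx ox)).2

/-- an inside path meets at most one outside vertical path at its anchor -/
theorem uniqB {u w p} (hp : 0 < C.h p) (hu : C.V u) (hw : C.V w) (h1 : C.S p (C.x u) 0) 
    (h2 : C.S p (C.x w) 0) : C.S w (C.x u) 0 := by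
  have := C.in2' hp h1 (C.anchV hu).1 h2 (C.anchV hw).1
  rw [this]; exact (C.anchV hw).2

theorem uniqD {u w p} (hp : 0 < C.h p) (hu : ¬ C.V u) (hw : ¬ C.V w) (h1 : C.S p 0 (C.x u)) 
    (h2 : C.S p 0 (C.x w)) : C.S w 0 (C.x u) := by
  have := C.in2 hp h1 (C.anchH hu).1 h2 (C.anchH hw).1
  rw [this]; exact (C.anchH hw).2

theorem in_outB (G : Gra C s t M) (nb : NoBC C) (hs : 0 < C.h s) (ht : C.h t < 0) (hv : C.V t) : 
    False := by
  obtain ⟨i, j, c1, c2⟩ := G.cst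
  have st := cB nb hv ht hs c2 c1
  have hout : ∀ x, M x → C.h x < 0 := by
    intro x hx
    refine (inout C x).resolve_left (fun h => ?_)
    obtain ⟨_, i', j', b1, b2⟩ := G.mt x hx
    exact C.inn (G.ms x hx).1 h hs (cB nb hv ht h b2 b1) st (C.anchV hv).1
  have hD : ∀ x, M x → ¬ C.V x := by
    intro x hx hxv
    obtain ⟨_, i', j', b1, b2⟩ := G.ms x hx
    have := cB nb hxv (hout x hx) hs b1 b2
    have := uniqB hs hv hxv st this
    exact C.out2 (G.mt x hx).1 (hout x hx) ht (by tauto) this (C.anchV hv).2 (C.anchV hv).1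
  obtain ⟨x, y, hx, hy, hne, h1, h2⟩ := G.two (fun x => C.S s 0 (C.x x)) (by
    intro x y hx hy h1 h2
    exact G.mm' hx hy (C.anchH (hD x hx)).2 (uniqD hs (hD x hx) (hD y hy) h1 h2))
  obtain ⟨_, i', j', b1, b2⟩ := G.ms x hx
  obtain ⟨_, i'', j'', d1, d2⟩ := G.mt x hx
  have := (cD (hD x hx) (hout x hx) hs b1 b2).resolve_left h1
  rcases C.out3 ht (hout x hx) hv (hD x hx) d2 d1 with ⟨rfl, rfl⟩ | h
  · obtain ⟨q1, q2, q3, q4⟩ := C.shV t hv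
    have : C.x t = 0 := by
      rw [q1] at d2
      unfold Vset at d2; omega
    rw [this] at st
    exact no0 hs st
  · have := C.hY
    omega

theorem in_outD (G : Gra C s t M) (nb : NoBC C) (hs : 0 < C.h s) (ht : C.h t < 0) (hv : ¬ C.V t) : 
    False := by
  obtain ⟨i, j, c1, c2⟩ := G.cst
  rcases cD hv ht hs c2 c1 with st | ⟨sv, es, es', et, et'⟩
  · obtain ⟨x, y, hx, hy, hne, h1, h2⟩ := G.two (fun x => C.V x ∧ C.S s (C.x x) 0) (by
      intro x y hx hy h1 h2
      exact G.mm' hx hy (C.anchV h1.1).2 (uniqB hs h1.1 h2.1 h1.2 h2.2))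
    have key : ∀ x, M x → ¬ (C.V x ∧ C.S s (C.x x) 0) → C.E s x := by
      intro x hx nx
      obtain ⟨xs, i', j', b1, b2⟩ := G.ms x hx
      obtain ⟨xt, i'', j'', d1, d2⟩ := G.mt x hx
      rcases inout C x with ix | ox
      · rcases cD hv ht ix d2 d1 with h | h
        · exact (C.inn xs ix hs h st (C.anchH hv).1).elim
        · refine (C.con_off xs (G.ms x hx).2 (fun i j a b c => C.inn xs ix hs a b c)).resolve_left ?_
          exact C.hookIn xs h.1 h.2.1 hs
      · exfalso
        by_cases xv : C.V x
        · exact nx ⟨xv, cB nb xv ox hs b1 b2⟩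
        · rcases cD xv ox hs b1 b2 with h | h
          · exact C.out2 xt ox ht (by tauto) (uniqD hs hv xv st h) (C.anchH hv).2 (C.anchH hv).1
          · exact C.noarm h.1 hs h.2.1 st (C.anchH hv).1
    exact hne (G.mm' hx hy (key x hx h1) (key y hy h2))
  · obtain ⟨x, y, hx, hy, hne, h1, h2⟩ := G.two (fun x => 0 < C.h x ∧ C.S x 0 (C.x t)) (by
      intro x y hx hy h1 h2
      exact G.mm' hx hy h1.2 h2.2)
    obtain ⟨xs, i', j', b1, b2⟩ := G.ms x hx
    obtain ⟨xt, i'', j'', d1, d2⟩ := G.mt x hx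
    rcases inout C x with ix | ox
    · rcases cD hv ht ix d2 d1 with h | h
      · exact h1 ⟨ix, h⟩
      · exact AA xs h.1 sv ix hs h.2.1 es (G.ms x hx).2
    · by_cases xv : C.V x
      · have sx := cB nb xv ox hs b1 b2
        rcases C.out3 ox ht xv hv d1 d2 with ⟨rfl, rfl⟩ | h
        · obtain ⟨q1, q2, q3, q4⟩ := C.shV x xv
          have : C.x x = 0 := by
            rw [q1] at d1
            unfold Vset at d1; omega
          rw [this] at sx
          exact no0 hs sx
        · have := C.hY
          omega
      · rcases cD xv ox hs b1 b2 with h | h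
        · exact C.noarm sv hs es h (C.anchH xv).1
        · exact DD xt xv hv ox ht h.2.2.2.2 et' (G.mt x hx).2

/-- three outside paths, two of different type, have a common point only at the origin -/
theorem noTriple {u w y i j} (hu : C.h u < 0) (hw : C.h w < 0) (uv : C.V u) (wv : ¬ C.V w) 
    (yu : y ≠ u) (yw : y ≠ w) (h1 : C.S u i j) (h2 : C.S w i j) (h3 : C.S y i j) : i = 0 ∧ j = 0 := by
  rcases C.out3 hu hw uv wv h1 h2 with h | h
  · exact h
  · by_cases yv : C.V y
    · exact (C.hookV yu yv uv h3 h1 h.1).elim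
    · exact (C.hookH yw yv wv h3 h2 h.2.1).elim

theorem on0 (C : Conf ι) : C.on 0 0 := by
  have := C.hX; have := C.hY; unfold Conf.on Onv; omega

/-- contacts of outside paths on `v` happen only at the origin -/
theorem out_on {u w i j} (hne : u ≠ w) (hu : C.h u < 0) (hw : C.h w < 0)
    (h1 : C.S u i j) (h3 : C.S w i j) (h2 : C.on i j) : i = 0 ∧ j = 0 ∧ (C.V u ↔ ¬ C.V w) := by
  by_cases ht : C.V u ↔ C.V w
  · exact (C.out2 hne hu hw ht h1 h3 h2).elim
  · have hh : C.V u ↔ ¬ C.V w := by tauto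
    refine ⟨?_, ?_, hh⟩ <;>
    · unfold Conf.on Onv at h2
      by_cases uv : C.V u
      · have := C.out3 hu hw uv (hh.1 uv) h1 h3
        omega
      · have := C.out3 hw hu (by tauto) uv h3 h1
        omega

theorem con_out {u w} (hne : u ≠ w) (hu : C.h u < 0) (hw : C.h w < 0) (hc : C.Con u w)
    (h0 : ¬ (C.S u 0 0 ∧ C.S w 0 0)) : C.E u w ∨ C.E w u := by
  refine C.con_off hne hc (fun i j a b c => ?_)
  obtain ⟨rfl, rfl, _⟩ := out_on hne hu hw a b c
  exact h0 ⟨a, b⟩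

/-- `s`, `t` outside of different type and two outside middle paths -/
theorem core (G : Gra C s t M) (hs : C.h s < 0) (ht : C.h t < 0) (sv : C.V s) (tv : ¬ C.V t) 
    {y z} (hy : M y) (hz : M z) (hne : y ≠ z) (oy : C.h y < 0) (oz : C.h z < 0)
    (c0 : ¬ (C.S s 0 0 ∧ C.S t 0 0)) (c1 : ¬ (C.S y 0 0 ∧ C.S s 0 0)) (c2 : ¬ (C.S y 0 0 ∧ C.S t 0 0))
    (c3 : ¬ (C.S z 0 0 ∧ C.S s 0 0)) (c4 : ¬ (C.S z 0 0 ∧ C.S t 0 0)) : False := by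
  refine G.k4 hy hz hne (con_out G.st hs ht G.cst c0) 
    (con_out (G.ms y hy).1 oy hs (G.ms y hy).2 c1) (con_out (G.mt y hy).1 oy ht (G.mt y hy).2 c2)
    (con_out (G.ms z hz).1 oz hs (G.ms z hz).2 c3) (con_out (G.mt z hz).1 oz ht (G.mt z hz).2 c4) ?_ ?_
  · intro i j h1 h2 h3
    obtain ⟨rfl, rfl⟩ := noTriple hs ht sv tv (G.ms y hy).1 (G.mt y hy).1 h1 h2 h3
    exact c0 ⟨h1, h2⟩
  · intro i j h1 h2 h3
    obtain ⟨rfl, rfl⟩ := noTriple hs ht sv tv (G.ms z hz).1 (G.mt z hz).1 h1 h2 h3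
    exact c0 ⟨h1, h2⟩

/-- at most two outside paths meet at the origin -/
theorem three0 {u w y} (hu : C.h u < 0) (hw : C.h w < 0) (hy : C.h y < 0) (h1 : u ≠ w) (h2 : u ≠ y) 
    (h3 : w ≠ y) (a : C.S u 0 0) (b : C.S w 0 0) (c : C.S y 0 0) : False := by
  have := (out_on h1 hu hw a b (on0 C)).2.2
  have := (out_on h2 hu hy a c (on0 C)).2.2
  have := (out_on h3 hw hy b c (on0 C)).2.2
  tauto

/-- `s, t` both of vertical type, `s` and the middle path `x` meet at the corner. -/
theorem allout_BB (G : Gra C s t M) (hs : C.h s < 0) (ht : C.h t < 0) (hM : ∀ x, M x → C.h x < 0)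
    {x} (hx : M x) (h1 : C.S s 0 0) (h2 : C.S x 0 0) (sv : C.V s) (tv : C.V t) : False := by
  have ox := hM x hx
  obtain ⟨xs, xsc⟩ := G.ms x hx
  obtain ⟨xt, i, j, d1, d2⟩ := G.mt x hx
  have xv : ¬ C.V x := by
    have := (out_on xs ox hs h2 h1 (on0 C)).2.2
    tauto
  have nt0 : ¬ C.S t 0 0 := fun h => three0 hs ox ht xs.symm G.st xt h1 h2 h
  have et : C.ei t < 0 := by
    rcases C.out3 ht ox tv xv d2 d1 with ⟨rfl, rfl⟩ | h
    · exact (nt0 d2).elim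
    · exact h.2.2.1
  have n1 : ¬ C.E t s := fun h => C.hookV G.st.symm tv sv (C.e_mem t) h et
  have e1 : C.E s t := (con_out G.st hs ht G.cst (fun h => nt0 h.2)).resolve_right n1
  obtain ⟨y, z, hy, hz, hne, ny, nz⟩ := G.two (fun y => y = x) (fun _ _ _ _ h h' => h.trans h'.symm)
  have conS : ∀ y, M y → y ≠ x → C.E y s ∨ C.E s y := by
    intro y hy ny
    exact con_out (G.ms y hy).1 (hM y hy) hs (G.ms y hy).2 
      (fun h => three0 hs ox (hM y hy) xs.symm (G.ms y hy).1.symm ny.symm h1 h2 h.1)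
  have conT : ∀ y, M y → C.E y t ∨ C.E t y := by
    intro y hy
    exact con_out (G.mt y hy).1 (hM y hy) ht (G.mt y hy).2 (fun h => nt0 h.2)
  have key : ∀ y, M y → y ≠ x → ¬ C.E t y → C.E s y := by
    intro y hy ny nE
    have e2 := (conT y hy).resolve_right nE
    rcases conS y hy ny with h | h
    · rcases C.disj s t G.st _ _ h e2 with h' | ⟨h', h''⟩ | ⟨h', h''⟩
      · exact (C.out2 G.st hs ht (by tauto) h e2 h').elim
      · unfold Conf.E; rw [← h', ← h'']; exact C.e_mem y
      · unfold Conf.E at h n1; rw [h', h''] at h; exact (n1 h).elim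
    · exact h
  have key2 : ∀ y z, M y → M z → y ≠ z → y ≠ x → z ≠ x → C.E t z → False := by
    intro y z hy hz hne ny nz hE
    have ny' : ¬ C.E t y := fun h => hne (G.mm' hy hz h hE)
    have sy := key y hy ny ny'
    have nsz : ¬ C.E s z := fun h => hne (G.mm' hy hz sy h)
    have zs := (conS z hz nz).resolve_right nsz
    have zv : ¬ C.V z := fun h => C.hookV (G.mt z hz).1.symm tv h (C.e_mem t) hE et
    have ez : C.ei z < 0 := by
      have := (C.shH z zv).2.2.1
      have := hM z hz
      omega
    have es : C.ei s < 0 := by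
      obtain ⟨q1, q2, q3, q4⟩ := C.shV s sv
      have := C.x0 s
      unfold Conf.E at zs
      rw [q1] at zs
      unfold Vset at zs; omega
    exact C.hookV G.st sv tv (C.e_mem s) e1 es
  by_cases tz : C.E t z
  · exact key2 y z hy hz hne ny nz tz
  by_cases ty : C.E t y
  · exact key2 z y hz hy hne.symm nz ny ty
  exact hne (G.mm' hy hz (key y hy ny ty) (key z hz nz tz))

theorem allout_aux (G : Gra C s t M) (hs : C.h s < 0) (ht : C.h t < 0) (hM : ∀ x, M x → C.h x < 0)
    {x} (hx : M x) (h1 : C.S s 0 0) (h2 : C.S x 0 0) (sv : C.V s) : False := by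
  by_cases tv : C.V t
  · exact G.allout_BB hs ht hM hx h1 h2 sv tv
  have ox := hM x hx
  obtain ⟨xs, xsc⟩ := G.ms x hx
  obtain ⟨xt, xtc⟩ := G.mt x hx
  have nt0 : ¬ C.S t 0 0 := fun h => three0 hs ox ht xs.symm G.st xt h1 h2 h
  obtain ⟨y, z, hy, hz, hne, ny, nz⟩ := G.two (fun y => y = x) (fun _ _ _ _ h h' => h.trans h'.symm)
  have k0 : ∀ y, M y → y ≠ x → ¬ C.S y 0 0 := fun y hy ny h => ny (G.mm' hy hx h h2)
  exact G.core hs ht sv tv hy hz hne (hM y hy) (hM z hz) (fun h => nt0 h.2) 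
    (fun h => k0 y hy ny h.1) (fun h => k0 y hy ny h.1) (fun h => k0 z hz nz h.1) (fun h => k0 z hz nz h.1)

theorem allout_aux2 (G : Gra C s t M) (hs : C.h s < 0) (ht : C.h t < 0) (hM : ∀ x, M x → C.h x < 0)
    {x} (hx : M x) (h1 : C.S s 0 0) (h2 : C.S x 0 0) : False := by
  by_cases sv : C.V s
  · exact G.allout_aux hs ht hM hx h1 h2 sv
  · exact G.swap.allout_aux hs ht hM hx h1 h2 sv

theorem allout (G : Gra C s t M) (hs : C.h s < 0) (ht : C.h t < 0) (hM : ∀ x, M x → C.h x < 0) :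
    False := by
  have k1 : ∀ x, M x → ¬ (C.S x 0 0 ∧ C.S s 0 0) := fun x hx h => G.allout_aux2 hs ht hM hx h.2 h.1
  have k2 : ∀ x, M x → ¬ (C.S x 0 0 ∧ C.S t 0 0) := fun x hx h => G.symm.allout_aux2 ht hs hM hx h.2 h.1
  refine G.k5 (fun x hx => con_out (G.ms x hx).1 (hM x hx) hs (G.ms x hx).2 (k1 x hx))
    (fun x hx => con_out (G.mt x hx).1 (hM x hx) ht (G.mt x hx).2 (k2 x hx)) ?_
  intro x hx h1 h2 h3
  have := out_on (G.ms x hx).1 (hM x hx) hs (C.e_mem x) h1 h3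
  refine k1 x hx ⟨?_, ?_⟩
  · have h4 := C.e_mem x; rwa [this.1, this.2.1] at h4
  · unfold Conf.E at h1; rwa [this.1, this.2.1] at h1

theorem outBD (G : Gra C s t M) (nb : NoBC C) (hs : C.h s < 0) (ht : C.h t < 0) 
    (sv : C.V s) (tv : ¬ C.V t) {x} (hx : M x) (ix : 0 < C.h x) : False := by
  have hxs : ∀ x, M x → 0 < C.h x → C.S x (C.x s) 0 := by
    intro x hx ix
    obtain ⟨xs, i, j, d1, d2⟩ := G.ms x hx
    exact cB nb sv hs ix d2 d1
  have s0 : ¬ C.S s 0 0 := by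
    intro h
    have : C.x s = 0 := by
      rw [(C.shV s sv).1] at h
      unfold Vset at h; omega
    have h2 := hxs x hx ix
    rw [this] at h2
    exact no0 ix h2
  have xt : C.S x 0 (C.x t) := by
    obtain ⟨xt, i, j, d1, d2⟩ := G.mt x hx
    obtain ⟨i', j', e1, e2⟩ := G.cst
    rcases cD tv ht ix d2 d1 with h | h
    · exact h
    · rcases C.out3 hs ht sv tv e1 e2 with ⟨rfl, rfl⟩ | h'
      · exact (s0 e1).elim
      · have := C.hY
        omega
  have t0 : ¬ C.S t 0 0 := by
    intro h
    have : C.x t = 0 := by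
      rw [(C.shH t tv).1] at h
      unfold Vset at h; omega
    rw [this] at xt
    exact no0 ix xt
  obtain ⟨y, z, hy, hz, hne, ny, nz⟩ := G.two (fun y => 0 < C.h y) 
    (fun y z hy hz h1 h2 => G.mm' hy hz (hxs y hy h1) (hxs z hz h2))
  exact G.core hs ht sv tv hy hz hne ((inout C y).resolve_left ny) ((inout C z).resolve_left nz)
    (fun h => s0 h.1) (fun h => s0 h.2) (fun h => t0 h.2) (fun h => s0 h.2) (fun h => t0 h.2)

theorem out_out (G : Gra C s t M) (nb : NoBC C) (hs : C.h s < 0) (ht : C.h t < 0) : False := by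
  by_cases hall : ∀ x, M x → C.h x < 0
  · exact G.allout hs ht hall
  push Not at hall
  obtain ⟨x, hx, ix⟩ := hall
  have ix : 0 < C.h x := by have := C.h0 x; omega
  by_cases sv : C.V s <;> by_cases tv : C.V t
  · obtain ⟨xs, i, j, a1, a2⟩ := G.ms x hx
    obtain ⟨xt, i', j', b1, b2⟩ := G.mt x hx
    have := uniqB ix sv tv (cB nb sv hs ix a2 a1) (cB nb tv ht ix b2 b1)
    exact C.out2 G.st hs ht (by tauto) (C.anchV sv).2 this (C.anchV sv).1
  · exact G.outBD nb hs ht sv tv hx ix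
  · exact G.symm.outBD nb ht hs tv sv hx ix
  · obtain ⟨xs, i, j, a1, a2⟩ := G.ms x hx
    obtain ⟨xt, i', j', b1, b2⟩ := G.mt x hx
    rcases cD sv hs ix a2 a1 with h | h <;> rcases cD tv ht ix b2 b1 with h' | h'
    · have := uniqD ix sv tv h h'
      exact C.out2 G.st hs ht (by tauto) (C.anchH sv).2 this (C.anchH sv).1
    · exact C.noarm h'.1 ix h'.2.1 h (C.anchH sv).1
    · exact C.noarm h.1 ix h.2.1 h' (C.anchH tv).1
    · exact DD G.st sv tv hs ht h.2.2.2.2 h'.2.2.2.2 G.cst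

theorem noBC_false (G : Gra C s t M) (nb : NoBC C) : False := by
  rcases inout C s with hs | hs <;> rcases inout C t with ht | ht
  · exact G.in_in nb hs ht
  · by_cases tv : C.V t
    · exact G.in_outB nb hs ht tv
    · exact G.in_outD nb hs ht tv
  · by_cases sv : C.V s
    · exact G.symm.in_outB nb ht hs sv
    · exact G.symm.in_outD nb ht hs sv
  · exact G.out_out nb hs ht

theorem final (G : Gra C s t M) : False := by
  by_cases nb : NoBC C
  · exact G.noBC_false nb
  by_cases nb' : NoBC C.swap
  · exact G.swap.noBC_false nb'
  unfold NoBC at nb nb'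
  push Not at nb nb'
  obtain ⟨u, w, i, j, uv, wv, hu, hw, h1, h2, h3⟩ := nb
  obtain ⟨u', w', i', j', uv', wv', hu', hw', h1', h2', h3'⟩ := nb'
  have wv' : C.V w' := not_not.mp wv'
  have a1 := C.swap.cAD (u := w) (w := u) wv (not_not.mpr uv) hw hu h2 h1
  have a2 := C.cAD (u := w') (w := u') wv' uv' hw' hu' h2' h1'
  have a1 : C.ej w < 0 ∧ C.X < C.ei w := by
    rcases a1 with ⟨b1, b2⟩ | h
    · exact (h3 b2 b1).elim
    · exact ⟨h.1, h.2.1⟩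
  have a2 : C.ei w' < 0 ∧ C.Y < C.ej w' := by
    rcases a2 with ⟨b1, b2⟩ | h
    · exact (h3' b2 b1).elim
    · exact ⟨h.1, h.2.1⟩
  obtain ⟨q1, q2, q3, q4⟩ := C.shH w wv
  obtain ⟨p1, p2, p3, p4⟩ := C.shV w' wv'
  have c1 := C.cor w
  have c2 := C.cor w'
  have x1 := C.x0 w
  have x2 := C.x0 w'
  have hne : w ≠ w' := fun h => wv (h ▸ wv')
  have := C.disj w w' hne (C.x w') (C.x w) (by rw [q1]; unfold Vset; omega) (by rw [p1]; unfold Vset; omega)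
  unfold Onv at this
  omega

end Gra


/-! ## Layer 2: normalization -/

theorem norm_p (X Y a b c d : ℤ) (hX : 0 ≤ X) (hY : 0 ≤ Y) (hne : ¬ (a = c ∧ b = d))
    (ht : Onv X Y a b)
    (hvd : ∀ i j, LS a b c d i j → Onv X Y i j → ((i = a ∧ j = b) ∨ (i = c ∧ j = d)) ∧
      ¬ (i = X ∧ j = 0) ∧ ¬ (i = 0 ∧ j = Y))
    (sh : ∀ i j, LS a b c d i j → LS a b c d (i+1) j → Onv X Y i j → Onv X Y (i+1) j → False)
    (sv : ∀ i j, LS a b c d i j → LS a b c d i (j+1) → Onv X Y i j → Onv X Y i (j+1) → False) :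
    ∃ (V : Prop) (x h m : ℤ), h ≠ 0 ∧ 0 ≤ x ∧ (x = 0 → h < 0) ∧
      (V → (∀ i j, LS a b c d i j ↔ Vset x h m i j) ∧ c = m ∧ d = h ∧ x < X ∧ a = x ∧ b = 0) ∧
      (¬ V → (∀ i j, LS a b c d i j ↔ Vset x h m j i) ∧ d = m ∧ c = h ∧ x < Y ∧ b = x ∧ a = 0) := by
  have hab := hvd a b (by unfold LS; omega) ht
  by_cases hbd : b = d
  · have hac : a ≠ c := fun h => hne ⟨h, hbd⟩
    have ha0 : a = 0 := by
      by_contra ha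
      unfold LS Onv at *
      rcases lt_or_gt_of_ne hac with h | h
      · exact sh a b (by omega) (by omega) (by omega) (by omega)
      · exact sh (a-1) b (by omega) (by omega) (by omega) (by omega)
    have hc0 : b = 0 → c < 0 := by
      intro hb
      by_contra hc
      unfold LS Onv at *
      exact sh 0 0 (by omega) (by omega) (by omega) (by omega)
    refine ⟨False, b, c, d, by omega, ?_, hc0, fun h => h.elim, fun _ => ⟨?_, rfl, rfl, ?_, rfl, ha0⟩⟩
    · unfold Onv at ht; omega
    · intro i j
      unfold LS Vset; omega
    · unfold Onv at ht; omega
  · have hb0 : b = 0 := by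
      by_contra hb
      unfold LS Onv at *
      rcases lt_or_gt_of_ne hbd with h | h
      · exact sv a b (by omega) (by omega) (by omega) (by omega)
      · exact sv a (b-1) (by omega) (by omega) (by omega) (by omega)
    have hc0 : a = 0 → d < 0 := by
      intro ha
      by_contra hd
      unfold LS Onv at *
      exact sv 0 0 (by omega) (by omega) (by omega) (by omega)
    refine ⟨True, a, d, c, by omega, ?_, hc0, fun _ => ⟨?_, rfl, rfl, ?_, rfl, hb0⟩, fun h => (h trivial).elim⟩
    · unfold Onv at ht; omega
    · intro i j
      unfold LS Vset; omega
    · unfold Onv at ht; omega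

theorem Onv_swap (X Y i j : ℤ) : Onv X Y i j ↔ Onv Y X j i := by
  unfold Onv; tauto

/-- Choice of anchor and free end for one path. -/
theorem norm_one (X Y a b c d : ℤ) (hX : 0 ≤ X) (hY : 0 ≤ Y) (hne : ¬ (a = c ∧ b = d))
    (ht : ∃ i j, LS a b c d i j ∧ Onv X Y i j)
    (hvd : ∀ i j, LS a b c d i j → Onv X Y i j → ((i = a ∧ j = b) ∨ (i = c ∧ j = d)) ∧
      ¬ (i = X ∧ j = 0) ∧ ¬ (i = 0 ∧ j = Y))
    (sh : ∀ i j, LS a b c d i j → LS a b c d (i+1) j → Onv X Y i j → Onv X Y (i+1) j → False)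
    (sv : ∀ i j, LS a b c d i j → LS a b c d i (j+1) → Onv X Y i j → Onv X Y i (j+1) → False) :
    ∃ (V : Prop) (x h m ei ej : ℤ), h ≠ 0 ∧ 0 ≤ x ∧ (x = 0 → h < 0) ∧
      (V → (∀ i j, LS a b c d i j ↔ Vset x h m i j) ∧ ei = m ∧ ej = h ∧ x < X) ∧
      (¬ V → (∀ i j, LS a b c d i j ↔ Vset x h m j i) ∧ ej = m ∧ ei = h ∧ x < Y) ∧
      (∀ i j, ((i = a ∧ j = b) ∨ (i = c ∧ j = d)) →
        (V ∧ i = x ∧ j = 0) ∨ (¬ V ∧ j = x ∧ i = 0) ∨ (i = ei ∧ j = ej)) := by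
  obtain ⟨i, j, h1, h2⟩ := ht
  rcases (hvd i j h1 h2).1 with ⟨rfl, rfl⟩ | ⟨rfl, rfl⟩
  · obtain ⟨V, x, h, m, q1, q2, q3, q4, q5⟩ := norm_p X Y i j c d hX hY hne h2 hvd sh sv
    refine ⟨V, x, h, m, c, d, q1, q2, q3, fun hv => ?_, fun hv => ?_, ?_⟩
    · obtain ⟨w1, w2, w3, w4, w5, w6⟩ := q4 hv
      exact ⟨w1, w2, w3, w4⟩
    · obtain ⟨w1, w2, w3, w4, w5, w6⟩ := q5 hv
      exact ⟨w1, w2, w3, w4⟩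
    · intro i' j' hij
      rcases hij with ⟨e1, e2⟩ | ⟨e1, e2⟩
      · by_cases hv : V
        · obtain ⟨w1, w2, w3, w4, w5, w6⟩ := q4 hv
          exact Or.inl ⟨hv, e1.trans w5, e2.trans w6⟩
        · obtain ⟨w1, w2, w3, w4, w5, w6⟩ := q5 hv
          exact Or.inr (Or.inl ⟨hv, e2.trans w5, e1.trans w6⟩)
      · exact Or.inr (Or.inr ⟨e1, e2⟩)
  · obtain ⟨V, x, h, m, q1, q2, q3, q4, q5⟩ := norm_p Y X j i b a hY hX (by omega) 
      ((Onv_swap _ _ _ _).1 h2)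
      (fun i' j' r1 r2 => by
        have := hvd j' i' ((LS_swap _ _ _ _ _ _).2 r1) ((Onv_swap _ _ _ _).2 r2)
        exact ⟨this.1.symm.imp And.symm And.symm, fun k => this.2.2 k.symm, fun k => this.2.1 k.symm⟩)
      (fun i' j' r1 r2 r3 r4 => sv j' i' ((LS_swap _ _ _ _ _ _).2 r1) ((LS_swap _ _ _ _ _ _).2 r2)
        ((Onv_swap _ _ _ _).2 r3) ((Onv_swap _ _ _ _).2 r4))
      (fun i' j' r1 r2 r3 r4 => sh j' i' ((LS_swap _ _ _ _ _ _).2 r1) ((LS_swap _ _ _ _ _ _).2 r2)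
        ((Onv_swap _ _ _ _).2 r3) ((Onv_swap _ _ _ _).2 r4))
    refine ⟨¬ V, x, h, m, a, b, q1, q2, q3, fun hv => ?_, fun hv => ?_, ?_⟩
    · obtain ⟨w1, w2, w3, w4, w5, w6⟩ := q5 hv
      exact ⟨fun i' j' => (LS_swap _ _ _ _ _ _).trans (w1 j' i'), w2, w3, w4⟩
    · obtain ⟨w1, w2, w3, w4, w5, w6⟩ := q4 (not_not.1 hv)
      exact ⟨fun i' j' => (LS_swap _ _ _ _ _ _).trans (w1 j' i'), w2, w3, w4⟩
    · intro i' j' hij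
      rcases hij with ⟨e1, e2⟩ | ⟨e1, e2⟩
      · exact Or.inr (Or.inr ⟨e1, e2⟩)
      · by_cases hv : V
        · obtain ⟨w1, w2, w3, w4, w5, w6⟩ := q4 hv
          exact Or.inr (Or.inl ⟨not_not.2 hv, e2.trans w5, e1.trans w6⟩)
        · obtain ⟨w1, w2, w3, w4, w5, w6⟩ := q5 hv
          exact Or.inl ⟨hv, e1.trans w5, e2.trans w6⟩

/-- Raw L-shape data: the path `v` and paths indexed by `ι`. -/
structure Raw (ι : Type) where
  va : ℤ
  vb : ℤ
  vc : ℤ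
  vd : ℤ
  a : ι → ℤ
  b : ι → ℤ
  c : ι → ℤ
  d : ι → ℤ
  ne : ∀ u, ¬ (a u = c u ∧ b u = d u)
  touch : ∀ u, ∃ i j, LS (a u) (b u) (c u) (d u) i j ∧ LS va vb vc vd i j
  vdisj : ∀ u i j, LS (a u) (b u) (c u) (d u) i j → LS va vb vc vd i j →
    ((i = a u ∧ j = b u) ∨ (i = c u ∧ j = d u)) ∧ ¬ (i = va ∧ j = vb) ∧ ¬ (i = vc ∧ j = vd)
  vsh : ∀ u i j, LS (a u) (b u) (c u) (d u) i j → LS (a u) (b u) (c u) (d u) (i+1) j →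
    LS va vb vc vd i j → LS va vb vc vd (i+1) j → False
  vsv : ∀ u i j, LS (a u) (b u) (c u) (d u) i j → LS (a u) (b u) (c u) (d u) i (j+1) →
    LS va vb vc vd i j → LS va vb vc vd i (j+1) → False
  disj : ∀ u w, u ≠ w → ∀ i j, LS (a u) (b u) (c u) (d u) i j → LS (a w) (b w) (c w) (d w) i j →
    ((i = a u ∧ j = b u) ∨ (i = c u ∧ j = d u)) ∨ ((i = a w ∧ j = b w) ∨ (i = c w ∧ j = d w))
  sh : ∀ u w, u ≠ w → ∀ i j, LS (a u) (b u) (c u) (d u) i j → LS (a u) (b u) (c u) (d u) (i+1) j →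
    LS (a w) (b w) (c w) (d w) i j → LS (a w) (b w) (c w) (d w) (i+1) j → False
  sv : ∀ u w, u ≠ w → ∀ i j, LS (a u) (b u) (c u) (d u) i j → LS (a u) (b u) (c u) (d u) i (j+1) →
    LS (a w) (b w) (c w) (d w) i j → LS (a w) (b w) (c w) (d w) i (j+1) → False

namespace Raw
variable {ι : Type}

def S (R : Raw ι) (u : ι) (i j : ℤ) : Prop := LS (R.a u) (R.b u) (R.c u) (R.d u) i j

theorem toConf_norm (R : Raw ι) (h1 : R.va = 0) (h2 : R.vd = 0) (h3 : 0 ≤ R.vb) (h4 : 0 ≤ R.vc) :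
    ∃ C : Conf ι, ∀ u i j, C.S u i j ↔ R.S u i j := by
  have hon : ∀ i j, LS R.va R.vb R.vc R.vd i j ↔ Onv R.vc R.vb i j := by
    intro i j
    unfold LS Onv
    omega
  have key := fun u => norm_one R.vc R.vb (R.a u) (R.b u) (R.c u) (R.d u) h4 h3 (R.ne u)
    (by simpa only [hon] using R.touch u) 
    (by
      intro i j r1 r2
      have := R.vdisj u i j r1 ((hon i j).2 r2)
      rw [h1, h2] at this
      exact ⟨this.1, this.2.2, this.2.1⟩)
    (by simpa only [hon] using R.vsh u) (by simpa only [hon] using R.vsv u)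
  choose V x h m ei ej k1 k2 k3 k4 k5 k6 using key
  refine ⟨{
      X := R.vc
      Y := R.vb
      V := V
      x := x
      h := h
      m := m
      S := R.S
      ei := ei
      ej := ej
      hX := h4
      hY := h3
      h0 := k1
      x0 := k2
      cor := k3
      shV := k4
      shH := k5
      vd := ?_
      disj := ?_
      segh := R.sh
      segv := R.sv
      }, fun u i j => Iff.rfl⟩
  · intro u i j r1 r2
    obtain ⟨e1, e2, e3⟩ := R.vdisj u i j r1 ((hon i j).2 r2)
    refine ⟨k6 u i j e1, ?_, ?_⟩
    · unfold Onv at r2; omega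
    · unfold Onv at r2; omega
  · intro u w hne i j r1 r2
    have aux : ∀ u, ((i = R.a u ∧ j = R.b u) ∨ (i = R.c u ∧ j = R.d u)) → 
        Onv R.vc R.vb i j ∨ (i = ei u ∧ j = ej u) := by
      intro u hu
      rcases k6 u i j hu with ⟨g1, g2, g3⟩ | ⟨g1, g2, g3⟩ | g
      · have := (k4 u g1).2.2.2
        have := k2 u
        left; unfold Onv; omega
      · have := (k5 u g1).2.2.2
        have := k2 u
        left; unfold Onv; omega
      · exact Or.inr g
    rcases R.disj u w hne i j r1 r2 with g | g
    · have := aux u g; tauto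
    · have := aux w g; tauto

theorem LS_aff (σ τ x y a b c d i j : ℤ) (hσ : σ = 1 ∨ σ = -1) (hτ : τ = 1 ∨ τ = -1) :
    LS (σ * (a - x)) (τ * (b - y)) (σ * (c - x)) (τ * (d - y)) i j ↔ 
      LS a b c d (σ * i + x) (τ * j + y) := by
  unfold LS
  rcases hσ with rfl | rfl <;> rcases hτ with rfl | rfl <;> omega

/-- Affine change of coordinates. -/
def aff (R : Raw ι) (σ τ x y : ℤ) (hσ : σ = 1 ∨ σ = -1) (hτ : τ = 1 ∨ τ = -1) : Raw ι where
  va := σ * (R.va - x)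
  vb := τ * (R.vb - y)
  vc := σ * (R.vc - x)
  vd := τ * (R.vd - y)
  a := fun u => σ * (R.a u - x)
  b := fun u => τ * (R.b u - y)
  c := fun u => σ * (R.c u - x)
  d := fun u => τ * (R.d u - y)
  ne := fun u => by
    have := R.ne u
    rcases hσ with rfl | rfl <;> rcases hτ with rfl | rfl <;> omega
  touch := fun u => by
    obtain ⟨i, j, h1, h2⟩ := R.touch u
    refine ⟨σ * (i - x), τ * (j - y), ?_⟩
    rw [LS_aff _ _ _ _ _ _ _ _ _ _ hσ hτ, LS_aff _ _ _ _ _ _ _ _ _ _ hσ hτ]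
    have e1 : σ * (σ * (i - x)) + x = i := by rcases hσ with rfl | rfl <;> omega
    have e2 : τ * (τ * (j - y)) + y = j := by rcases hτ with rfl | rfl <;> omega
    rw [e1, e2]
    exact ⟨h1, h2⟩
  vdisj := fun u i j h1 h2 => by
    rw [LS_aff _ _ _ _ _ _ _ _ _ _ hσ hτ] at h1 h2
    have := R.vdisj u _ _ h1 h2
    clear h1 h2
    rcases hσ with rfl | rfl <;> rcases hτ with rfl | rfl <;> omega
  vsh := fun u i j h1 h2 h3 h4 => by
    rw [LS_aff _ _ _ _ _ _ _ _ _ _ hσ hτ] at h1 h2 h3 h4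
    rcases hσ with rfl | rfl
    · rw [show 1 * (i + 1) + x = 1 * i + x + 1 by ring] at h2 h4
      exact R.vsh u _ _ h1 h2 h3 h4
    · rw [show -1 * i + x = -1 * (i + 1) + x + 1 by ring] at h1 h3
      exact R.vsh u _ _ h2 h1 h4 h3
  vsv := fun u i j h1 h2 h3 h4 => by
    rw [LS_aff _ _ _ _ _ _ _ _ _ _ hσ hτ] at h1 h2 h3 h4
    rcases hτ with rfl | rfl
    · rw [show 1 * (j + 1) + y = 1 * j + y + 1 by ring] at h2 h4
      exact R.vsv u _ _ h1 h2 h3 h4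
    · rw [show -1 * j + y = -1 * (j + 1) + y + 1 by ring] at h1 h3
      exact R.vsv u _ _ h2 h1 h4 h3
  disj := fun u w hne i j h1 h2 => by
    rw [LS_aff _ _ _ _ _ _ _ _ _ _ hσ hτ] at h1 h2
    have := R.disj u w hne _ _ h1 h2
    clear h1 h2
    rcases hσ with rfl | rfl <;> rcases hτ with rfl | rfl <;> omega
  sh := fun u w hne i j h1 h2 h3 h4 => by
    rw [LS_aff _ _ _ _ _ _ _ _ _ _ hσ hτ] at h1 h2 h3 h4
    rcases hσ with rfl | rfl
    · rw [show 1 * (i + 1) + x = 1 * i + x + 1 by ring] at h2 h4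
      exact R.sh u w hne _ _ h1 h2 h3 h4
    · rw [show -1 * i + x = -1 * (i + 1) + x + 1 by ring] at h1 h3
      exact R.sh u w hne _ _ h2 h1 h4 h3
  sv := fun u w hne i j h1 h2 h3 h4 => by
    rw [LS_aff _ _ _ _ _ _ _ _ _ _ hσ hτ] at h1 h2 h3 h4
    rcases hτ with rfl | rfl
    · rw [show 1 * (j + 1) + y = 1 * j + y + 1 by ring] at h2 h4
      exact R.sv u w hne _ _ h1 h2 h3 h4
    · rw [show -1 * j + y = -1 * (j + 1) + y + 1 by ring] at h1 h3
      exact R.sv u w hne _ _ h2 h1 h4 h3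

theorem toConf (R : Raw ι) : ∃ C : Conf ι, ∀ u w, C.Con u w ↔ ∃ i j, R.S u i j ∧ R.S w i j := by
  obtain ⟨σ, hσ, s1⟩ : ∃ σ : ℤ, (σ = 1 ∨ σ = -1) ∧ 0 ≤ σ * (R.vc - R.va) := by
    rcases le_total R.va R.vc with h | h
    · exact ⟨1, Or.inl rfl, by omega⟩
    · exact ⟨-1, Or.inr rfl, by omega⟩
  obtain ⟨τ, hτ, t1⟩ : ∃ τ : ℤ, (τ = 1 ∨ τ = -1) ∧ 0 ≤ τ * (R.vb - R.vd) := by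
    rcases le_total R.vd R.vb with h | h
    · exact ⟨1, Or.inl rfl, by omega⟩
    · exact ⟨-1, Or.inr rfl, by omega⟩
  obtain ⟨C, hC⟩ := (R.aff σ τ R.va R.vd hσ hτ).toConf_norm (by simp [aff]) (by simp [aff]) t1 s1
  have hS : ∀ u i j, C.S u i j ↔ R.S u (σ * i + R.va) (τ * j + R.vd) := by
    intro u i j
    rw [hC]
    exact LS_aff _ _ _ _ _ _ _ _ _ _ hσ hτ
  refine ⟨C, fun u w => ⟨?_, ?_⟩⟩
  · rintro ⟨i, j, h1, h2⟩
    exact ⟨_, _, (hS u i j).1 h1, (hS w i j).1 h2⟩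
  · rintro ⟨i, j, h1, h2⟩
    have e1 : σ * (σ * (i - R.va)) + R.va = i := by rcases hσ with rfl | rfl <;> omega
    have e2 : τ * (τ * (j - R.vd)) + R.vd = j := by rcases hτ with rfl | rfl <;> omega
    refine ⟨σ * (i - R.va), τ * (j - R.vd), ?_, ?_⟩
    · rw [hS, e1, e2]; exact h1
    · rw [hS, e1, e2]; exact h2

end Raw


/-! ## Main theorem -/

theorem endpoint_iff (P : GridPath) (a b c d : ℤ)
    (h : ((a, b) = P.first ∧ (c, d) = P.last) ∨ ((a, b) = P.last ∧ (c, d) = P.first)) (i j : ℤ) :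
    P.IsEndpoint (i, j) ↔ ((i = a ∧ j = b) ∨ (i = c ∧ j = d)) := by
  unfold GridPath.IsEndpoint
  rcases h with ⟨h1, h2⟩ | ⟨h1, h2⟩
  · rw [← h1, ← h2]; simp only [Prod.mk.injEq]
  · rw [← h1, ← h2]; simp only [Prod.mk.injEq]; exact or_comm

theorem gridStep_h (i j : ℤ) : GridStep (i, j) (i+1, j) := by
  unfold GridStep; simp

theorem gridStep_v (i j : ℤ) : GridStep (i, j) (i, j+1) := by
  unfold GridStep; simp

theorem main_aux (R : CPGRep Gv) (hR : R.BendsAtMost 1)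
    (hf : ∀ p, (R.path GvV.v).IsEndpoint p → ∀ u, u ≠ GvV.v → p ∉ (R.path u).toSet) : False := by
  have key := fun u => path_shape (R.path u) (hR u)
  choose a b c d h1 h2 h3 h4 using key
  have hend := fun u => endpoint_iff (R.path u) _ _ _ _ (h1 u)
  have hadj : ∀ u w, u ≠ w → (Gv.Adj u w ↔ ∃ i j, LS (a u) (b u) (c u) (d u) i j ∧
      LS (a w) (b w) (c w) (d w) i j) := by
    intro u w hne
    rw [R.adj_iff u w hne]
    constructor
    · rintro ⟨⟨i, j⟩, g1, g2⟩
      exact ⟨i, j, (h3 u i j).1 g1, (h3 w i j).1 g2⟩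
    · rintro ⟨i, j, g1, g2⟩
      exact ⟨(i, j), (h3 u i j).2 g1, (h3 w i j).2 g2⟩
  have hsh : ∀ u w, u ≠ w → ∀ i j, LS (a u) (b u) (c u) (d u) i j →
      LS (a u) (b u) (c u) (d u) (i+1) j →
      LS (a w) (b w) (c w) (d w) i j → LS (a w) (b w) (c w) (d w) (i+1) j → False := by
    intro u w hne i j g1 g2 g3 g4
    rw [← h3] at g1 g2 g3 g4
    exact R.no_shared_segment u w hne _ _ (h4 u _ _ g1 g2 (gridStep_h i j))
      (h4 w _ _ g3 g4 (gridStep_h i j))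
  have hsv : ∀ u w, u ≠ w → ∀ i j, LS (a u) (b u) (c u) (d u) i j →
      LS (a u) (b u) (c u) (d u) i (j+1) →
      LS (a w) (b w) (c w) (d w) i j → LS (a w) (b w) (c w) (d w) i (j+1) → False := by
    intro u w hne i j g1 g2 g3 g4
    rw [← h3] at g1 g2 g3 g4
    exact R.no_shared_segment u w hne _ _ (h4 u _ _ g1 g2 (gridStep_v i j))
      (h4 w _ _ g3 g4 (gridStep_v i j))
  have hv : ∀ u, u ≠ GvV.v → Gv.Adj u GvV.v := by
    intro u hu
    refine (SimpleGraph.fromRel_adj _ _ _).2 ⟨hu, ?_⟩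
    cases u
    · exact (hu rfl).elim
    · exact Or.inr GvRel.vs
    · exact Or.inl GvRel.tv
    · exact Or.inl GvRel.av
    · exact Or.inl GvRel.bv
    · exact Or.inl GvRel.cv
  let Q : Raw {u : GvV // u ≠ GvV.v} :=
    { va := a GvV.v
      vb := b GvV.v
      vc := c GvV.v
      vd := d GvV.v
      a := fun u => a u.1
      b := fun u => b u.1
      c := fun u => c u.1
      d := fun u => d u.1
      ne := fun u h => h2 u.1 (Prod.ext h.1 h.2)
      touch := fun u => (hadj u.1 _ u.2).1 (hv u.1 u.2)
      vdisj := by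
        intro u i j g1 g2
        have m1 := (h3 _ i j).2 g1
        have m2 := (h3 _ i j).2 g2
        have hn : ¬ (R.path GvV.v).IsEndpoint (i, j) := fun he => hf _ he u.1 u.2 m1
        refine ⟨(hend u.1 i j).1 ((R.interiorly_disjoint u.1 _ u.2 _ m1 m2).resolve_right hn), ?_, ?_⟩
        · exact fun h => hn ((hend _ i j).2 (Or.inl h))
        · exact fun h => hn ((hend _ i j).2 (Or.inr h))
      vsh := fun u => hsh u.1 _ u.2
      vsv := fun u => hsv u.1 _ u.2
      disj := by
        intro u w hne i j g1 g2
        exact (R.interiorly_disjoint u.1 w.1 (fun h => hne (Subtype.ext h)) (i, j)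
          ((h3 _ i j).2 g1) ((h3 _ i j).2 g2)).imp (hend _ i j).1 (hend _ i j).1
      sh := fun u w hne => hsh u.1 w.1 (fun h => hne (Subtype.ext h))
      sv := fun u w hne => hsv u.1 w.1 (fun h => hne (Subtype.ext h)) }
  obtain ⟨C, hC⟩ := Q.toConf
  have hcon : ∀ u w : {u : GvV // u ≠ GvV.v}, u ≠ w → (C.Con u w ↔ Gv.Adj u.1 w.1) := by
    intro u w hne
    rw [hC, hadj u.1 w.1 (fun h => hne (Subtype.ext h))]
    rfl
  let s : {u : GvV // u ≠ GvV.v} := ⟨GvV.s, by simp⟩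
  let t : {u : GvV // u ≠ GvV.v} := ⟨GvV.t, by simp⟩
  let M : {u : GvV // u ≠ GvV.v} → Prop := fun u => u.1 = GvV.a ∨ u.1 = GvV.b ∨ u.1 = GvV.c
  have hst : s ≠ t := fun h => by simpa [s, t] using congrArg Subtype.val h
  refine Gra.final (C := C) (s := s) (t := t) (M := M) ?_
  refine
    { st := hst
      cst := (hcon s t hst).2 ((SimpleGraph.fromRel_adj _ _ _).2 ⟨by simp [s, t], Or.inl GvRel.st⟩)
      ms := ?_
      mt := ?_
      mm := ?_
      three := ?_ }
  · rintro ⟨x, hx⟩ hM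
    have hne : (⟨x, hx⟩ : {u : GvV // u ≠ GvV.v}) ≠ s := by
      rintro h
      have h := congrArg Subtype.val h
      rcases hM with rfl | rfl | rfl <;> simp [s] at h
    refine ⟨hne, (hcon _ _ hne).2 ((SimpleGraph.fromRel_adj _ _ _).2
      ⟨fun h => hne (Subtype.ext h), Or.inl ?_⟩)⟩
    rcases hM with h | h | h <;> simp only at h <;> subst h
    · exact GvRel.as'
    · exact GvRel.bs
    · exact GvRel.cs
  · rintro ⟨x, hx⟩ hM
    have hne : (⟨x, hx⟩ : {u : GvV // u ≠ GvV.v}) ≠ t := by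
      rintro h
      have h := congrArg Subtype.val h
      rcases hM with rfl | rfl | rfl <;> simp [t] at h
    refine ⟨hne, (hcon _ _ hne).2 ((SimpleGraph.fromRel_adj _ _ _).2
      ⟨fun h => hne (Subtype.ext h), Or.inl ?_⟩)⟩
    rcases hM with h | h | h <;> simp only at h <;> subst h
    · exact GvRel.at'
    · exact GvRel.bt
    · exact GvRel.ct
  · rintro ⟨x, hx⟩ ⟨y, hy⟩ hM hN hne hc
    have := (SimpleGraph.fromRel_adj _ _ _).1 ((hcon _ _ hne).1 hc)
    rcases hM with h | h | h <;> simp only at h <;> subst h <;>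
      rcases hN with h | h | h <;> simp only at h <;> subst h <;>
      rcases this with ⟨-, h | h⟩ <;> cases h
  · refine ⟨⟨GvV.a, by simp⟩, ⟨GvV.b, by simp⟩, ⟨GvV.c, by simp⟩, Or.inl rfl, Or.inr (Or.inl rfl),
      Or.inr (Or.inr rfl), ?_, ?_, ?_⟩ <;> simp

/-- In every 1-bend CPG representation of `G(v)`, at most one endpoint of `P_v` is free:
it cannot be that both endpoints of `P_v` belong to no other path. -/
theorem Gv_path_v_not_both_endpoints_free (R : CPGRep Gv) (hR : R.BendsAtMost 1) :
    ¬ (R.FreeEndpoint GvV.v (R.path GvV.v).first ∧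
       R.FreeEndpoint GvV.v (R.path GvV.v).last) := by
  rintro ⟨⟨-, g1⟩, ⟨-, g2⟩⟩
  refine main_aux R hR ?_
  rintro p (rfl | rfl)
  · exact g1
  · exact g2
end

section
/- In every 1-bend CPG representation of the graph E_1, the path P_v representing the vertex v has no free endpoint: each of its two endpoints belongs to some other path of the representation. -/
/-! ## The end-eating graph `E_1` -/

/-- The eleven vertices of the end-eating graph `E_1`: the special vertex `v` together
with two copies (indexed by `Bool`) of the vertices `s, t, a, b, c`. -/
inductive E1V where
  | v : E1V
  | s : Bool → E1V
  | t : Bool → E1V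
  | a : Bool → E1V
  | b : Bool → E1V
  | c : Bool → E1V

/-- The edges of `E_1`: for each copy `ι`, the edges `v s_ι`, `s_ι t_ι`, `t_ι v`, and every
edge joining one of `a_ι, b_ι, c_ι` to one of `v, s_ι, t_ι`; `E_1` consists of two copies
of `G(v)` with the two copies of `v` identified. -/
inductive E1Rel : E1V → E1V → Prop
  | vs (ι : Bool) : E1Rel E1V.v (E1V.s ι)
  | st (ι : Bool) : E1Rel (E1V.s ι) (E1V.t ι)
  | tv (ι : Bool) : E1Rel (E1V.t ι) E1V.v
  | av (ι : Bool) : E1Rel (E1V.a ι) E1V.v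
  | as' (ι : Bool) : E1Rel (E1V.a ι) (E1V.s ι)
  | at' (ι : Bool) : E1Rel (E1V.a ι) (E1V.t ι)
  | bv (ι : Bool) : E1Rel (E1V.b ι) E1V.v
  | bs (ι : Bool) : E1Rel (E1V.b ι) (E1V.s ι)
  | bt (ι : Bool) : E1Rel (E1V.b ι) (E1V.t ι)
  | cv (ι : Bool) : E1Rel (E1V.c ι) E1V.v
  | cs (ι : Bool) : E1Rel (E1V.c ι) (E1V.s ι)
  | ct (ι : Bool) : E1Rel (E1V.c ι) (E1V.t ι)

/-- The end-eating graph `E_1`. -/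
def E1 : SimpleGraph E1V := SimpleGraph.fromRel E1Rel


/-! ## Abstract shapes -/

structure PS where
  On : ℤ → ℤ → Prop
  End : ℤ → ℤ → Prop

def PS.swap (w : PS) : PS := ⟨fun x y => w.On y x, fun x y => w.End y x⟩

def Bw (a b x : ℤ) : Prop := (a ≤ x ∧ x ≤ b) ∨ (b ≤ x ∧ x ≤ a)

/-- Vertical start at `(q,0)`, bend at `(q,h)`, tip at `(e,h)`. -/
def mkV (q h e : ℤ) : PS :=
  ⟨fun x y => (x = q ∧ Bw 0 h y) ∨ (y = h ∧ Bw q e x),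
   fun x y => (x = q ∧ y = 0) ∨ (x = e ∧ y = h)⟩

/-- Horizontal start at `(0,r)`, bend at `(l,r)`, tip at `(l,f)`. -/
def mkH (r l f : ℤ) : PS :=
  ⟨fun x y => (y = r ∧ Bw 0 l x) ∨ (x = l ∧ Bw r f y),
   fun x y => (y = r ∧ x = 0) ∨ (y = f ∧ x = l)⟩

theorem swap_mkV (q h e : ℤ) : (mkV q h e).swap = mkH q h e := rfl
theorem swap_mkH (q h e : ℤ) : (mkH q h e).swap = mkV q h e := rfl

def VOK (A B q h e : ℤ) : Prop :=
  0 ≤ q ∧ q < A ∧ h ≠ 0 ∧ (q = 0 → h < 0) ∧ (0 < h → e < 0 → B < h) ∧ (0 < h → e = 0 → h ≠ B)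

def Rooted (A B : ℤ) (w : PS) : Prop :=
  (∃ q h e, w = mkV q h e ∧ VOK A B q h e) ∨ (∃ r l f, w = mkH r l f ∧ VOK B A r l f)

def OnV (A B x y : ℤ) : Prop := (y = 0 ∧ 0 ≤ x ∧ x ≤ A) ∨ (x = 0 ∧ 0 ≤ y ∧ y ≤ B)

structure Dis (P Q : PS) : Prop where
  pt : ∀ x y, P.On x y → Q.On x y → P.End x y ∨ Q.End x y
  hs : ∀ x y, ¬ (P.On x y ∧ P.On (x+1) y ∧ Q.On x y ∧ Q.On (x+1) y)
  vs : ∀ x y, ¬ (P.On x y ∧ P.On x (y+1) ∧ Q.On x y ∧ Q.On x (y+1))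

def Meet (P Q : PS) : Prop := ∃ x y, P.On x y ∧ Q.On x y

theorem Meet.symm {P Q : PS} (h : Meet P Q) : Meet Q P := by
  obtain ⟨x, y, a, b⟩ := h
  exact ⟨x, y, b, a⟩

theorem Meet.swap {P Q : PS} (h : Meet P Q) : Meet P.swap Q.swap := by
  obtain ⟨x, y, a, b⟩ := h
  exact ⟨y, x, a, b⟩

theorem Dis.symm {P Q : PS} (h : Dis P Q) : Dis Q P :=
  ⟨fun x y a b => (h.pt x y b a).symm, fun x y ⟨a, b, c, d⟩ => h.hs x y ⟨c, d, a, b⟩,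
   fun x y ⟨a, b, c, d⟩ => h.vs x y ⟨c, d, a, b⟩⟩

theorem Dis.swap {P Q : PS} (h : Dis P Q) : Dis P.swap Q.swap :=
  ⟨fun x y a b => h.pt y x a b, fun x y h' => h.vs y x h',
   fun x y h' => h.hs y x h'⟩

theorem Dis.np {P Q : PS} (h : Dis P Q) (x y : ℤ) :
    ¬ (P.On x y ∧ Q.On x y ∧ ¬ P.End x y ∧ ¬ Q.End x y) := by
  have := h.pt x y
  tauto

theorem Rooted.swap {A B : ℤ} {w : PS} (h : Rooted A B w) : Rooted B A w.swap := by
  rcases h with ⟨q, h, e, rfl, ok⟩ | ⟨q, h, e, rfl, ok⟩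
  · exact Or.inr ⟨q, h, e, rfl, ok⟩
  · exact Or.inl ⟨q, h, e, rfl, ok⟩

theorem mkH_eq_mkV (r l : ℤ) : mkH r l 0 = mkV l r 0 := by
  simp only [mkH, mkV, PS.mk.injEq]
  constructor
  · funext x y
    apply propext
    simp only [Bw]
    omega
  · funext x y
    apply propext
    omega

/-- A rooted path through a point of the open horizontal arm is vertical there. -/
theorem Rooted.vform {A B : ℤ} {w : PS} (h : Rooted A B w) {q : ℤ} (hq : 0 < q) (hqA : q < A)
    (on : w.On q 0) : ∃ k e, w = mkV q k e ∧ VOK A B q k e := by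
  rcases h with ⟨q', h, e, rfl, ok⟩ | ⟨r, l, f, rfl, ok⟩
  · have : q' = q := by
      simp only [mkV, Bw, VOK] at *
      omega
    subst this
    exact ⟨h, e, rfl, ok⟩
  · have : l = q ∧ f = 0 ∧ 0 < r ∧ r < B := by
      simp only [mkH, Bw, VOK] at *
      omega
    obtain ⟨rfl, rfl, h3, h4⟩ := this
    refine ⟨r, 0, mkH_eq_mkV _ _, ?_⟩
    simp only [VOK] at *
    omega

structure Core (A B : ℤ) (s t x y z : PS) : Prop where
  rs : Rooted A B s
  rt : Rooted A B t
  rx : Rooted A B x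
  ry : Rooted A B y
  rz : Rooted A B z
  dst : Dis s t
  dsx : Dis s x
  dsy : Dis s y
  dsz : Dis s z
  dtx : Dis t x
  dty : Dis t y
  dtz : Dis t z
  mst : Meet s t
  msx : Meet s x
  msy : Meet s y
  msz : Meet s z
  mtx : Meet t x
  mty : Meet t y
  mtz : Meet t z
  nxy : ¬ Meet x y
  nxz : ¬ Meet x z
  nyz : ¬ Meet y z

section
variable {A B : ℤ} {s t x y z : PS}

theorem not_meet_swap {P Q : PS} (h : ¬ Meet P Q) : ¬ Meet P.swap Q.swap :=
  fun m => h m.swap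

theorem Core.swap (c : Core A B s t x y z) :
    Core B A s.swap t.swap x.swap y.swap z.swap :=
  ⟨c.rs.swap, c.rt.swap, c.rx.swap, c.ry.swap, c.rz.swap, c.dst.swap, c.dsx.swap, c.dsy.swap,
   c.dsz.swap, c.dtx.swap, c.dty.swap, c.dtz.swap, c.mst.swap, c.msx.swap, c.msy.swap,
   c.msz.swap, c.mtx.swap, c.mty.swap, c.mtz.swap, not_meet_swap c.nxy, not_meet_swap c.nxz,
   not_meet_swap c.nyz⟩

theorem Core.swapST (c : Core A B s t x y z) : Core A B t s x y z :=
  ⟨c.rt, c.rs, c.rx, c.ry, c.rz, c.dst.symm, c.dtx, c.dty, c.dtz, c.dsx, c.dsy, c.dsz,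
   c.mst.symm, c.mtx, c.mty, c.mtz, c.msx, c.msy, c.msz, c.nxy, c.nxz, c.nyz⟩

theorem Core.swapXY (c : Core A B s t x y z) : Core A B s t y x z :=
  ⟨c.rs, c.rt, c.ry, c.rx, c.rz, c.dst, c.dsy, c.dsx, c.dsz, c.dty, c.dtx, c.dtz,
   c.mst, c.msy, c.msx, c.msz, c.mty, c.mtx, c.mtz, fun h => c.nxy h.symm, c.nyz, c.nxz⟩

theorem Core.swapYZ (c : Core A B s t x y z) : Core A B s t x z y :=
  ⟨c.rs, c.rt, c.rx, c.rz, c.ry, c.dst, c.dsx, c.dsz, c.dsy, c.dtx, c.dtz, c.dty,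
   c.mst, c.msx, c.msz, c.msy, c.mtx, c.mtz, c.mty, c.nxz, c.nxy, fun h => c.nyz h.symm⟩

/-- Off-`v` endpoint of `s` on `y`. -/
def TipOn (A B : ℤ) (s y : PS) : Prop := ∃ a b, ¬ OnV A B a b ∧ s.End a b ∧ y.On a b

def Share (A B : ℤ) (s y : PS) : Prop := ∃ a b, OnV A B a b ∧ s.On a b ∧ y.On a b

theorem Rooted.tip_unique (h : Rooted A B s) {a b a' b' : ℤ} (h1 : ¬ OnV A B a b)
    (h2 : ¬ OnV A B a' b') (e1 : s.End a b) (e2 : s.End a' b') : a = a' ∧ b = b' := by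
  rcases h with ⟨q, h, e, rfl, ok⟩ | ⟨r, l, f, rfl, ok⟩ <;>
  simp only [mkV, mkH, OnV, VOK] at * <;> omega

theorem Rooted.end_on (h : Rooted A B s) {a b : ℤ} (e1 : s.End a b) : s.On a b := by
  rcases h with ⟨q, h, e, rfl, ok⟩ | ⟨r, l, f, rfl, ok⟩ <;>
  simp only [mkV, mkH, Bw] at * <;> omega

theorem stepA (ry : Rooted A B y) (dst : Dis s t)
    (dsy : Dis s y) (dty : Dis t y) (msy : Meet s y) (mty : Meet t y) :
    Share A B s y ∨ Share A B t y ∨ TipOn A B s y ∨ TipOn A B t y := by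
  obtain ⟨a, b, h1, h2⟩ := msy
  obtain ⟨a', b', h1', h2'⟩ := mty
  by_cases v : OnV A B a b
  · exact Or.inl ⟨a, b, v, h1, h2⟩
  by_cases v' : OnV A B a' b'
  · exact Or.inr (Or.inl ⟨a', b', v', h1', h2'⟩)
  rcases dsy.pt a b h1 h2 with e | e
  · exact Or.inr (Or.inr (Or.inl ⟨a, b, v, e, h2⟩))
  rcases dty.pt a' b' h1' h2' with e' | e'
  · exact Or.inr (Or.inr (Or.inr ⟨a', b', v', e', h2'⟩))
  obtain ⟨rfl, rfl⟩ := ry.tip_unique v v' e e'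
  rcases dst.pt a b h1 h1' with e'' | e''
  · exact Or.inr (Or.inr (Or.inl ⟨a, b, v, e'', h2⟩))
  · exact Or.inr (Or.inr (Or.inr ⟨a, b, v, e'', h2⟩))

theorem tip_meet (rs : Rooted A B s) (hy : TipOn A B s y) (hz : TipOn A B s z) : Meet y z := by
  obtain ⟨a, b, v, e, o⟩ := hy
  obtain ⟨a', b', v', e', o'⟩ := hz
  obtain ⟨rfl, rfl⟩ := rs.tip_unique v v' e e'
  exact ⟨a, b, o, o'⟩

theorem Core.tips (c : Core A B s t x y z) (h1 : ¬ Share A B s y) (h2 : ¬ Share A B t y)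
    (h3 : ¬ Share A B s z) (h4 : ¬ Share A B t z) :
    (TipOn A B s y ∧ TipOn A B t z) ∨ (TipOn A B t y ∧ TipOn A B s z) := by
  have hy := stepA c.ry c.dst c.dsy c.dty c.msy c.mty
  have hz := stepA c.rz c.dst c.dsz c.dtz c.msz c.mtz
  have n1 : ¬ (TipOn A B s y ∧ TipOn A B s z) := fun h => c.nyz (tip_meet c.rs h.1 h.2)
  have n2 : ¬ (TipOn A B t y ∧ TipOn A B t z) := fun h => c.nyz (tip_meet c.rt h.1 h.2)
  tauto

/-- Two vertical paths do not share a point in the third quadrant. -/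
theorem Q3V {q h e q' h' e' : ℤ} (ok : VOK A B q h e) (ok' : VOK A B q' h' e')
    (d : Dis (mkV q h e) (mkV q' h' e')) {a b : ℤ} (ha : a < 0)
    (o : (mkV q h e).On a b) (o' : (mkV q' h' e').On a b) : False := by
  have := d.hs a b
  simp only [mkV, Bw, VOK] at *
  omega

theorem Q3H {q h e q' h' e' : ℤ} (ok : VOK A B q h e) (ok' : VOK A B q' h' e')
    (d : Dis (mkH q h e) (mkH q' h' e')) {a b : ℤ} (ha : b < 0)
    (o : (mkH q h e).On a b) (o' : (mkH q' h' e').On a b) : False := by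
  have := d.vs a b
  simp only [mkH, Bw, VOK] at *
  omega

/-- `s` vertical, `t` horizontal meeting only in the third quadrant, with tips used. -/
theorem thirdQuadrant {q h e r l f : ℤ} (c : Core A B (mkV q h e) (mkH r l f) x y z)
    (ok : VOK A B q h e) (ok' : VOK B A r l f)
    (h1 : ¬ Share A B (mkV q h e) y) (h2 : ¬ Share A B (mkH r l f) y)
    (h3 : ¬ Share A B (mkV q h e) z) (h4 : ¬ Share A B (mkH r l f) z)
    (hq : ∀ a b, (mkV q h e).On a b → (mkH r l f).On a b → a < 0 ∧ b < 0) : False := by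
  obtain ⟨a, b, o1, o2⟩ := c.mst
  obtain ⟨ha, hb⟩ := hq a b o1 o2
  have nv : ¬ OnV A B a b := by
    simp only [OnV]; omega
  have key : ∀ w, Rooted A B w → Dis (mkV q h e) w → Dis (mkH r l f) w → w.On a b → False := by
    intro w rw ds dt ow
    rcases rw with ⟨q', h', e', rfl, ok2⟩ | ⟨r', l', f', rfl, ok2⟩
    · exact Q3V ok ok2 ds ha o1 ow
    · exact Q3H ok' ok2 dt hb o2 ow
  have ht := c.tips h1 h2 h3 h4
  have ex : y.On a b ∨ z.On a b := by
    rcases c.dst.pt a b o1 o2 with e1 | e1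
    · rcases ht with ⟨⟨a', b', v', e', o'⟩, -⟩ | ⟨-, ⟨a', b', v', e', o'⟩⟩
      · obtain ⟨rfl, rfl⟩ := c.rs.tip_unique nv v' e1 e'
        exact Or.inl o'
      · obtain ⟨rfl, rfl⟩ := c.rs.tip_unique nv v' e1 e'
        exact Or.inr o'
    · rcases ht with ⟨-, ⟨a', b', v', e', o'⟩⟩ | ⟨⟨a', b', v', e', o'⟩, -⟩
      · obtain ⟨rfl, rfl⟩ := c.rt.tip_unique nv v' e1 e'
        exact Or.inr o'
      · obtain ⟨rfl, rfl⟩ := c.rt.tip_unique nv v' e1 e'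
        exact Or.inl o'
  rcases ex with o | o
  · exact key y c.ry c.dsy c.dty o
  · exact key z c.rz c.dsz c.dtz o

/-- No rooted path other than an up and a down path goes through `(q,0)`. -/
theorem occupied {q h e h' e' : ℤ} (hq : 0 < q) (hqA : q < A) {w : PS}
    (hh : 0 < h) (hh' : h' < 0) (rw : Rooted A B w)
    (d : Dis (mkV q h e) w) (d' : Dis (mkV q h' e') w) : ¬ w.On q 0 := by
  intro o
  obtain ⟨k, e'', rfl, ok⟩ := rw.vform hq hqA o
  have h1 := d.vs q 0
  have h2 := d'.vs q (-1)
  simp only [mkV, Bw, VOK, true_and] at *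
  omega

/-- `t` not passing through `(q,0)` where an up and a down path meet cannot be vertical. -/
theorem not_vert {q h e h' e' q' k j : ℤ} (hh : 0 < h) (hh' : h' < 0)
    (ok : VOK A B q' k j) (hn : ¬ (mkV q' k j).On q 0)
    (m : Meet (mkV q' k j) (mkV q h e)) (m' : Meet (mkV q' k j) (mkV q h' e')) : False := by
  obtain ⟨a, b, o1, o2⟩ := m
  obtain ⟨a', b', o1', o2'⟩ := m'
  simp only [mkV, Bw, VOK] at *
  omega

/-- `t` goes left: then the up path is a closed one ending at the root of `t`. -/
theorem left_case {q h e h' e' r l f : ℤ} (hq : 0 < q) (hh : 0 < h) (hh' : h' < 0)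
    (oku : VOK A B q h e) (okt : VOK B A r l f) (hl : l < 0)
    (m : Meet (mkH r l f) (mkV q h e)) (m' : Meet (mkH r l f) (mkV q h' e')) :
    e = 0 ∧ h = r ∧ f < 0 ∧ e' < 0 ∧ 0 < r := by
  obtain ⟨a, b, o1, o2⟩ := m
  obtain ⟨a', b', o1', o2'⟩ := m'
  simp only [mkV, mkH, Bw, VOK] at *
  omega

/-- `t` goes right: it wraps around the end of the horizontal arm. -/
theorem right_case {q h' e' r l f : ℤ} (hq : 0 < q) (hh' : h' < 0)
    (okt : VOK B A r l f) (okd : VOK A B q h' e') (hl : 0 < l) (hn : ¬ (mkH r l f).On q 0)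
    (m' : Meet (mkH r l f) (mkV q h' e')) :
    A < l ∧ f < 0 ∧ l ≤ e' ∧ 0 < r := by
  obtain ⟨a', b', o1', o2'⟩ := m'
  simp only [mkV, mkH, Bw, VOK] at *
  omega

set_option maxHeartbeats 4000000 in
/-- The wrapping case with `s` below the arm. -/
theorem wrap1 {q h e h' e' r l f : ℤ} (hq : 0 < q) (hqA : q < A) (hh : 0 < h) (hh' : h' < 0)
    (okt : VOK B A r l f) (hl : A < l) (hf : f < 0) (he' : l ≤ e')
    (rx : Rooted A B y) (ds : Dis (mkV q h' e') y) (dt : Dis (mkH r l f) y)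
    (hn : ¬ y.On q 0)
    (ms : Meet (mkV q h' e') y) (mt : Meet (mkH r l f) y) : False := by
  obtain ⟨a, b, o1, o2⟩ := ms
  obtain ⟨a', b', o1', o2'⟩ := mt
  rcases rx with ⟨q', k, j, rfl, ok⟩ | ⟨r', l', f', rfl, ok⟩
  · rcases lt_or_gt_of_ne ok.2.2.1 with hk | hk
    · have hj : l ≤ j := by
        clear ds dt
        simp only [mkV, mkH, Bw, VOK] at *
        omega
      have hqq : q' ≠ q := by
        clear ds dt
        rintro rfl
        simp only [mkV, mkH, Bw, VOK, true_and] at *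
        omega
      have i1 := ds.hs (l-1) k
      have i2 := ds.np q k
      have i3 := ds.np q' h'
      clear ds dt o1' o2' hn
      simp only [mkV, mkH, Bw, VOK, true_and] at *
      omega
    · clear ds dt o1' o2'
      simp only [mkV, mkH, Bw, VOK] at *
      omega
  · rcases lt_or_gt_of_ne ok.2.2.1 with hk | hk
    · clear ds dt
      simp only [mkV, mkH, Bw, VOK] at *
      omega
    · have hj : A < l' ∧ f' < 0 ∧ 0 < r' := by
        clear ds dt o1' o2'
        simp only [mkV, mkH, Bw, VOK] at *
        omega
      have i1 := dt.vs l (-1)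
      have i2 := dt.hs 0 r
      have i3 := dt.np l r'
      have i4 := dt.np l' r
      clear ds dt o1 o2 hn
      simp only [mkV, mkH, Bw, VOK, true_and] at *
      omega

/-- An up path meeting the wrapping path ends to the right of the vertical axis. -/
theorem wrap_up {q h e r l f a b : ℤ} (hq : 0 < q) (hl : A < l) (hh : 0 < h)
    (ok : VOK A B q h e) (hr : 0 < r) (o1 : (mkV q h e).On a b) (o2 : (mkH r l f).On a b)
    (d : Dis (mkV q h e) (mkH r l f)) : 0 < e := by
  by_contra he
  have hA : q < A := ok.2.1
  clear ok
  have hhr : r ≤ h := by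
    clear d
    simp only [mkV, mkH, Bw] at *
    omega
  rcases lt_or_eq_of_le hhr with h1 | rfl
  · apply d.np q r
    clear d o1 o2
    simp only [mkV, mkH, Bw, true_and]
    omega
  · apply d.hs 0 r
    clear d o1 o2
    simp only [mkV, mkH, Bw, true_and]
    omega

set_option maxHeartbeats 4000000 in
/-- A shared point on the open horizontal arm is impossible. -/
theorem Core.caseI (c : Core A B s t x y z) {q : ℤ} (hq : 0 < q) (hqA : q < A)
    (os : s.On q 0) (ox : x.On q 0) : False := by
  obtain ⟨hs, es, rfl, oks⟩ := c.rs.vform hq hqA os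
  obtain ⟨hx, ex, rfl, okx⟩ := c.rx.vform hq hqA ox
  have opp : (hs < 0 ∧ 0 < hx) ∨ (0 < hs ∧ hx < 0) := by
    have i1 := c.dsx.vs q 0
    have i2 := c.dsx.vs q (-1)
    have j1 := oks.2.2.1
    have j2 := okx.2.2.1
    clear c os ox oks okx
    simp only [mkV, Bw, true_and] at *
    omega
  rcases opp with ⟨n1, n2⟩ | ⟨n1, n2⟩
  · -- `s` down, `x` up
    have occ : ∀ w, Rooted A B w → Dis (mkV q hs es) w → Dis (mkV q hx ex) w → ¬ w.On q 0 :=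
      fun w rw d1 d2 => occupied hq hqA n2 n1 rw d2 d1
    have tn := occ t c.rt c.dst c.dtx.symm
    rcases c.rt with ⟨q', k, j, rfl, ok⟩ | ⟨r, l, f, rfl, ok⟩
    · exact not_vert n2 n1 ok tn c.mtx c.mst.symm
    rcases lt_or_gt_of_ne ok.2.2.1 with hl | hl
    · obtain ⟨rfl, rfl, hf, hes, hr⟩ := left_case hq n2 n1 okx ok hl c.mtx c.mst.symm
      have nsh : ∀ w, Rooted A B w → Dis (mkV q hs es) w → Dis (mkH hx l f) w →
          ¬ Meet (mkV q hx 0) w →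
          ¬ Share A B (mkV q hs es) w ∧ ¬ Share A B (mkH hx l f) w := by
        intro w rw ds dt nm
        constructor
        · rintro ⟨a, b, v, o1, o2⟩
          apply nm
          refine ⟨a, b, ?_, o2⟩
          clear c nm tn os ox occ ds dt o2
          simp only [mkV, Bw, VOK, OnV] at *
          omega
        · rintro ⟨a, b, v, o1, o2⟩
          apply nm
          refine ⟨a, b, ?_, o2⟩
          clear c nm tn os ox occ ds dt o2
          simp only [mkV, mkH, Bw, VOK, OnV] at *
          omega
      obtain ⟨s1, s2⟩ := nsh y c.ry c.dsy c.dty c.nxy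
      obtain ⟨s3, s4⟩ := nsh z c.rz c.dsz c.dtz c.nxz
      refine thirdQuadrant c oks ok s1 s2 s3 s4 ?_
      intro a b o1 o2
      clear c nsh s1 s2 s3 s4 tn occ oks okx ok os ox
      simp only [mkV, mkH, Bw] at *
      omega
    · obtain ⟨h1, h2, h3, h4⟩ := right_case hq n1 ok oks hl tn c.mst.symm
      refine wrap1 (e := ex) hq hqA n2 n1 ok h1 h2 h3 c.ry c.dsy c.dty ?_ c.msy c.mty
      intro o
      exact c.nxy ⟨q, 0, ox, o⟩
  · -- `s` up, `x` down
    have tn := occupied hq hqA n1 n2 c.rt c.dst c.dtx.symm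
    rcases c.rt with ⟨q', k, j, rfl, ok⟩ | ⟨r, l, f, rfl, ok⟩
    · exact not_vert n1 n2 ok tn c.mst.symm c.mtx
    rcases lt_or_gt_of_ne ok.2.2.1 with hl | hl
    · obtain ⟨rfl, rfl, hf, hes, hr⟩ := left_case hq n1 n2 oks ok hl c.mst.symm c.mtx
      have nsh : ∀ w, Rooted A B w → Dis (mkV q hs 0) w → Dis (mkH hs l f) w →
          ¬ Meet (mkV q hx ex) w →
          ¬ Share A B (mkV q hs 0) w ∧ ¬ Share A B (mkH hs l f) w := by
        intro w rw ds dt nm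
        have k1 : ¬ w.On q 0 := fun o => nm ⟨q, 0, ox, o⟩
        have k2 : ¬ w.On 0 hs := by
          intro o
          have i1 := ds.hs 0 hs
          have i2 := dt.hs (-1) hs
          rcases rw with ⟨q', h', e', rfl, ok2⟩ | ⟨r', l', f', rfl, ok2⟩
          · clear c ds dt nm k1
            simp only [mkV, mkH, Bw, VOK, true_and] at *
            omega
          · clear c ds dt nm k1
            simp only [mkV, mkH, Bw, VOK, true_and] at *
            omega
        constructor
        · rintro ⟨a, b, v, o1, o2⟩
          have : (a = q ∧ b = 0) ∨ (a = 0 ∧ b = hs) := by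
            clear c ds dt nm k1 k2
            simp only [mkV, Bw, VOK, OnV] at *
            omega
          rcases this with ⟨rfl, rfl⟩ | ⟨rfl, rfl⟩
          · exact k1 o2
          · exact k2 o2
        · rintro ⟨a, b, v, o1, o2⟩
          have : (a = 0 ∧ b = hs) := by
            clear c ds dt nm k1 k2
            simp only [mkV, mkH, Bw, VOK, OnV] at *
            omega
          rcases this with ⟨rfl, rfl⟩
          exact k2 o2
      obtain ⟨s1, s2⟩ := nsh y c.ry c.dsy c.dty c.nxy
      obtain ⟨s3, s4⟩ := nsh z c.rz c.dsz c.dtz c.nxz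
      have nt : ∀ w, ¬ TipOn A B (mkV q hs 0) w := by
        rintro w ⟨a, b, v, e, o⟩
        clear c nsh s1 s2 s3 s4
        simp only [mkV, mkH, Bw, VOK, OnV] at *
        omega
      rcases c.tips s1 s2 s3 s4 with ⟨a, -⟩ | ⟨-, a⟩
      · exact nt _ a
      · exact nt _ a
    · obtain ⟨h1, h2, h3, h4⟩ := right_case hq n2 ok okx hl tn c.mtx
      have hes : 0 < es := by
        obtain ⟨a, b, o1, o2⟩ := c.mst
        exact wrap_up hq h1 n1 oks h4 o1 o2 c.dst
      have nsh : ∀ w, Rooted A B w → Dis (mkV q hs es) w → Dis (mkH r l f) w →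
          ¬ Meet (mkV q hx ex) w → Meet (mkV q hs es) w →
          ¬ Share A B (mkV q hs es) w ∧ ¬ Share A B (mkH r l f) w := by
        intro w rw ds dt nm mm
        have k1 : ¬ w.On q 0 := fun o => nm ⟨q, 0, ox, o⟩
        constructor
        · rintro ⟨a, b, v, o1, o2⟩
          have : (a = q ∧ b = 0) := by
            clear c ds dt nm mm k1
            simp only [mkV, Bw, VOK, OnV] at *
            omega
          rcases this with ⟨rfl, rfl⟩
          exact k1 o2
        · rintro ⟨a, b, v, o1, o2⟩
          have : (a = 0 ∧ b = r) := by
            clear c ds dt nm mm k1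
            simp only [mkV, mkH, Bw, VOK, OnV] at *
            omega
          rcases this with ⟨rfl, rfl⟩
          have i1 := dt.hs 0 b
          obtain ⟨a', b', p1, p2⟩ := mm
          rcases rw with ⟨q', h', e', rfl, ok2⟩ | ⟨r', l', f', rfl, ok2⟩
          · clear c ds dt nm k1
            simp only [mkV, mkH, Bw, VOK, true_and] at *
            omega
          · clear c ds dt nm k1
            simp only [mkV, mkH, Bw, VOK, true_and] at *
            omega
      obtain ⟨s1, s2⟩ := nsh y c.ry c.dsy c.dty c.nxy c.msy
      obtain ⟨s3, s4⟩ := nsh z c.rz c.dsz c.dtz c.nxz c.msz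
      have nt : ∀ w, Rooted A B w → Dis (mkH r l f) w →
          ¬ Meet (mkV q hx ex) w → Meet (mkV q hs es) w → ¬ TipOn A B (mkH r l f) w := by
        rintro w rw dt nm ⟨a', b', p1, p2⟩ ⟨a, b, v, e, o⟩
        have k1 : ¬ w.On q 0 := fun o => nm ⟨q, 0, ox, o⟩
        have i1 := dt.vs l f
        rcases rw with ⟨q', h', e', rfl, ok2⟩ | ⟨r', l', f', rfl, ok2⟩
        · clear c nsh s1 s2 s3 s4 nm dt i1
          simp only [mkV, mkH, Bw, VOK, OnV, true_and] at *
          omega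
        · clear c nsh s1 s2 s3 s4 nm dt k1 p1 p2
          simp only [mkV, mkH, Bw, VOK, OnV, true_and] at *
          omega
      rcases c.tips s1 s2 s3 s4 with ⟨-, a⟩ | ⟨a, -⟩
      · exact nt _ c.rz c.dtz c.nxz c.msz a
      · exact nt _ c.ry c.dty c.nxy c.msy a

theorem Rooted.at_zero {w : PS} (rw : Rooted A B w) (o : w.On 0 0) :
    (∃ h e, w = mkV 0 h e ∧ VOK A B 0 h e) ∨ (∃ l f, w = mkH 0 l f ∧ VOK B A 0 l f) := by
  rcases rw with ⟨q', h', e', rfl, ok⟩ | ⟨r', l', f', rfl, ok⟩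
  · have : q' = 0 := by
      simp only [mkV, mkH, Bw, VOK] at *
      omega
    subst this
    exact Or.inl ⟨_, _, rfl, ok⟩
  · have : r' = 0 := by
      simp only [mkV, mkH, Bw, VOK] at *
      omega
    subst this
    exact Or.inr ⟨_, _, rfl, ok⟩

/-- Two vertical paths do not both start at the corner. -/
theorem zeroVV {h e h' e' : ℤ} (ok : VOK A B 0 h e) (ok' : VOK A B 0 h' e')
    (d : Dis (mkV 0 h e) (mkV 0 h' e')) : False := by
  have h1 := ok.2.2.2.1 rfl
  have h2 := ok'.2.2.2.1 rfl
  have := d.vs 0 (-1)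
  clear ok ok' d
  simp only [mkV, Bw, VOK, true_and] at *
  omega

theorem zeroHH {h e h' e' : ℤ} (ok : VOK B A 0 h e) (ok' : VOK B A 0 h' e')
    (d : Dis (mkH 0 h e) (mkH 0 h' e')) : False :=
  zeroVV ok ok' d.swap

theorem occupied0 {h e l f : ℤ} (ok : VOK A B 0 h e) (ok' : VOK B A 0 l f) {w : PS}
    (rw : Rooted A B w) (d : Dis (mkV 0 h e) w) (d' : Dis (mkH 0 l f) w) : ¬ w.On 0 0 := by
  intro o
  rcases rw.at_zero o with ⟨h, e, rfl, k⟩ | ⟨h, e, rfl, k⟩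
  · exact zeroVV ok k d
  · exact zeroHH ok' k d'

theorem geo0 {hd ed lg fg r l f : ℤ} (ok : VOK B A r l f) (z2 : hd < 0) (z3 : lg < 0)
    (tn : ¬ (mkH r l f).On 0 0) (m : Meet (mkV 0 hd ed) (mkH r l f))
    (m' : Meet (mkH r l f) (mkH 0 lg fg)) : 0 < r ∧ l < 0 ∧ f < 0 ∧ ed < 0 := by
  obtain ⟨a, b, o1, o2⟩ := m
  obtain ⟨a', b', o1', o2'⟩ := m'
  have hr : 0 < r := by
    clear o1 o2 o1' o2'
    simp only [mkH, Bw, VOK] at *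
    omega
  obtain ⟨-, -, hl0, -⟩ := ok
  have hl : l < 0 := by
    clear o1 o2 tn
    simp only [mkH, Bw] at *
    omega
  clear o1' o2' tn
  simp only [mkV, mkH, Bw] at *
  omega

theorem throughV {q' h' e' r l f : ℤ} (ok : VOK A B q' h' e') (hr : 0 < r) (hl : l < 0)
    (o : (mkV q' h' e').On 0 r) (dt : Dis (mkH r l f) (mkV q' h' e')) :
    0 < q' ∧ h' = r ∧ e' = 0 := by
  have h1 : 0 < q' ∧ h' = r ∧ e' ≤ 0 := by
    clear dt
    simp only [mkV, Bw, VOK] at *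
    omega
  obtain ⟨h2, rfl, h3⟩ := h1
  refine ⟨h2, rfl, ?_⟩
  by_contra h4
  apply dt.hs (-1) h'
  clear dt o ok
  simp only [mkV, mkH, Bw, true_and]
  omega

theorem throughH {r' l' f' r l f : ℤ} (ok : VOK B A r' l' f') (hr : 0 < r) (hl : l < 0)
    (o : (mkH r' l' f').On 0 r) (dt : Dis (mkH r l f) (mkH r' l' f')) :
    r' = r ∧ 0 < l' := by
  have h1 : r' = r ∧ l' ≠ 0 := by
    clear dt
    simp only [mkH, Bw, VOK] at *
    omega
  obtain ⟨rfl, h3⟩ := h1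
  refine ⟨rfl, ?_⟩
  by_contra h4
  apply dt.hs (-1) r'
  clear dt o ok
  simp only [mkH, Bw, true_and]
  omega

/-- The path `w` through the tip of `t` must also use the tip of `s`. -/
theorem tip_transfer {q' h' e' lg fg r l f : ℤ} (ok2 : VOK A B q' h' e') (z3 : lg < 0)
    (hr : 0 < r) (hl : l < 0) (hf : f < 0)
    (dst : Dis (mkH 0 lg fg) (mkH r l f)) (ds : Dis (mkH 0 lg fg) (mkV q' h' e'))
    (m : Meet (mkH 0 lg fg) (mkV q' h' e')) (k1 : ¬ (mkV q' h' e').On 0 0)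
    (o : (mkV q' h' e').On l f) : TipOn A B (mkH 0 lg fg) (mkV q' h' e') := by
  obtain ⟨a', b', p1, p2⟩ := m
  have hq : 0 ≤ q' := ok2.1
  have hw : h' = f ∧ e' ≤ l := by
    clear ds dst p1 p2 k1
    simp only [mkV, Bw, VOK] at *
    omega
  obtain ⟨rfl, he⟩ := hw
  have hq0 : 0 < q' := by
    clear ds dst p1 p2 o ok2
    simp only [mkV, Bw] at *
    omega
  have hm : a' = lg ∧ b' = h' ∧ fg ≤ h' := by
    clear ds dst k1 o ok2
    simp only [mkV, mkH, Bw] at *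
    omega
  obtain ⟨rfl, rfl, hfg⟩ := hm
  have h1 : l < a' := by
    by_contra h
    rcases lt_or_eq_of_le (not_lt.1 h) with h | rfl
    · apply dst.np l 0
      clear ds dst k1 o ok2 p1 p2
      simp only [mkH, Bw, true_and]
      omega
    · apply dst.vs a' b'
      clear ds dst k1 o ok2 p1 p2
      simp only [mkH, Bw, true_and]
      omega
  have h2 : fg = b' := by
    by_contra h
    apply ds.np a' b'
    refine ⟨p1, p2, ?_, ?_⟩
    · clear ds dst k1 o ok2 p1 p2
      simp only [mkH]
      omega
    · clear ds dst k1 o ok2 p1 p2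
      simp only [mkV]
      omega
  subst h2
  refine ⟨a', fg, ?_, ?_, p2⟩
  · simp only [OnV]
    omega
  · exact Or.inr ⟨rfl, rfl⟩

/-- A shared point at the corner is impossible (`t` horizontal). -/
theorem Core.caseII {r l f : ℤ} (c : Core A B s (mkH r l f) x y z) (ok : VOK B A r l f)
    (os : s.On 0 0) (ox : x.On 0 0) : False := by
  have z1 : ∀ {A B h e : ℤ}, VOK A B 0 h e → h < 0 := fun k => k.2.2.2.1 rfl
  rcases c.rs.at_zero os with ⟨hd, ed, rfl, okd⟩ | ⟨lg, fg, rfl, okg⟩ <;>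
  rcases c.rx.at_zero ox with ⟨hd', ed', rfl, okd'⟩ | ⟨lg', fg', rfl, okg'⟩
  · exact zeroVV okd okd' c.dsx
  · have tn := occupied0 okd okg' c.rt c.dst c.dtx.symm
    have z2 := z1 okd
    have z3 := z1 okg'
    obtain ⟨hr, hl, hf, hed⟩ := geo0 ok z2 z3 tn c.mst c.mtx
    have nsh : ∀ w, Rooted A B w → Dis (mkH r l f) w → Meet (mkV 0 hd ed) w → ¬ w.On 0 0 →
        ¬ Share A B (mkV 0 hd ed) w ∧ ¬ Share A B (mkH r l f) w := by
      intro w rw dt mm k1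
      constructor
      · rintro ⟨a, b, v, o1, o2⟩
        have : (a = 0 ∧ b = 0) := by
          clear z1 c dt mm k1 tn ok okd okg' os ox o2
          simp only [mkV, Bw, OnV] at *
          omega
        rcases this with ⟨rfl, rfl⟩
        exact k1 o2
      · rintro ⟨a, b, v, o1, o2⟩
        have : (a = 0 ∧ b = r) := by
          clear z1 c dt mm k1 tn ok okd okg' os ox o2
          simp only [mkH, Bw, OnV] at *
          omega
        rcases this with ⟨rfl, rfl⟩
        obtain ⟨a', b', p1, p2⟩ := mm
        rcases rw with ⟨q', h', e', rfl, ok2⟩ | ⟨r', l', f', rfl, ok2⟩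
        · obtain ⟨e1, rfl, rfl⟩ := throughV ok2 hr hl o2 dt
          clear z1 c dt tn ok okd okg' os ox ok2 v o1 o2 k1
          simp only [mkV, Bw] at *
          omega
        · obtain ⟨rfl, e1⟩ := throughH ok2 hr hl o2 dt
          clear z1 c dt tn ok okd okg' os ox ok2 v o1 o2 k1
          simp only [mkV, mkH, Bw] at *
          omega
    obtain ⟨s1, s2⟩ := nsh y c.ry c.dty c.msy (fun o => c.nxy ⟨0, 0, ox, o⟩)
    obtain ⟨s3, s4⟩ := nsh z c.rz c.dtz c.msz (fun o => c.nxz ⟨0, 0, ox, o⟩)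
    refine thirdQuadrant c okd ok s1 s2 s3 s4 ?_
    intro a b o1 o2
    clear z1 c nsh s1 s2 s3 s4 tn ok okd okg' os ox
    simp only [mkV, mkH, Bw] at *
    omega
  · have tn := occupied0 okd' okg c.rt c.dtx.symm c.dst
    have z2 := z1 okd'
    have z3 := z1 okg
    obtain ⟨hr, hl, hf, hed⟩ := geo0 ok z2 z3 tn c.mtx.symm c.mst.symm
    have nsh : ∀ w, Rooted A B w → Dis (mkH r l f) w → Meet (mkH 0 lg fg) w → ¬ w.On 0 0 →
        ¬ Share A B (mkH 0 lg fg) w ∧ ¬ Share A B (mkH r l f) w := by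
      intro w rw dt mm k1
      constructor
      · rintro ⟨a, b, v, o1, o2⟩
        have : (a = 0 ∧ b = 0) := by
          clear z1 c dt mm k1 tn ok okd' okg os ox o2
          simp only [mkH, Bw, OnV] at *
          omega
        rcases this with ⟨rfl, rfl⟩
        exact k1 o2
      · rintro ⟨a, b, v, o1, o2⟩
        have : (a = 0 ∧ b = r) := by
          clear z1 c dt mm k1 tn ok okd' okg os ox o2
          simp only [mkH, Bw, OnV] at *
          omega
        rcases this with ⟨rfl, rfl⟩
        obtain ⟨a', b', p1, p2⟩ := mm
        rcases rw with ⟨q', h', e', rfl, ok2⟩ | ⟨r', l', f', rfl, ok2⟩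
        · obtain ⟨e1, rfl, rfl⟩ := throughV ok2 hr hl o2 dt
          clear z1 c dt tn ok okd' okg os ox ok2 v o1 o2 k1
          simp only [mkV, mkH, Bw] at *
          omega
        · obtain ⟨rfl, e1⟩ := throughH ok2 hr hl o2 dt
          clear z1 c dt tn ok okd' okg os ox ok2 v o1 o2 k1
          simp only [mkH, Bw] at *
          omega
    obtain ⟨s1, s2⟩ := nsh y c.ry c.dty c.msy (fun o => c.nxy ⟨0, 0, ox, o⟩)
    obtain ⟨s3, s4⟩ := nsh z c.rz c.dtz c.msz (fun o => c.nxz ⟨0, 0, ox, o⟩)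
    have key : ∀ w, Rooted A B w → Dis (mkH r l f) w → Dis (mkH 0 lg fg) w →
        Meet (mkH 0 lg fg) w → ¬ w.On 0 0 → TipOn A B (mkH r l f) w →
        TipOn A B (mkH 0 lg fg) w := by
      rintro w rw dt ds mm k1 ⟨a, b, v, e, o⟩
      have hab : a = l ∧ b = f := by
        clear z1 c nsh s1 s2 s3 s4 ds dt mm k1 o tn okd' okg os ox
        simp only [mkH, VOK, OnV] at *
        omega
      obtain ⟨rfl, rfl⟩ := hab
      rcases rw with ⟨q', h', e', rfl, ok2⟩ | ⟨r', l', f', rfl, ok2⟩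
      · exact tip_transfer ok2 z3 hr hl hf c.dst ds mm k1 o
      · exact (Q3H ok ok2 dt hf (by
          simp only [mkH, Bw, true_and]
          omega) o).elim
    rcases c.tips s1 s2 s3 s4 with ⟨a, b⟩ | ⟨a, b⟩
    · exact c.nyz (tip_meet c.rs a (key z c.rz c.dtz c.dsz c.msz
        (fun o => c.nxz ⟨0, 0, ox, o⟩) b))
    · exact c.nyz (tip_meet c.rs (key y c.ry c.dty c.dsy c.msy
        (fun o => c.nxy ⟨0, 0, ox, o⟩) a) b)
  · exact zeroHH okg okg' c.dsx

theorem Rooted.not_vend {w : PS} (rw : Rooted A B w) (hA : 0 ≤ A) (hB : 0 ≤ B) :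
    ¬ (0 < A ∧ w.On A 0) ∧ ¬ (0 < B ∧ w.On 0 B) := by
  rcases rw with ⟨q', h', e', rfl, ok⟩ | ⟨r', l', f', rfl, ok⟩ <;>
  simp only [mkV, mkH, Bw, VOK] at * <;> omega

theorem Core.share (c : Core A B s t x y z) (hA : 0 ≤ A) (hB : 0 ≤ B)
    (h : Share A B s x) : False := by
  obtain ⟨a, b, v, os, ox⟩ := h
  have nv := c.rs.not_vend hA hB
  by_cases h0 : a = 0 ∧ b = 0
  · obtain ⟨rfl, rfl⟩ := h0
    rcases c.rt with ⟨q', h', e', rfl, ok⟩ | ⟨r', l', f', rfl, ok⟩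
    · exact Core.caseII (r := q') (l := h') (f := e') c.swap ok os ox
    · exact c.caseII ok os ox
  · rcases v with ⟨rfl, v1, v2⟩ | ⟨rfl, v1, v2⟩
    · have : a ≠ A := by
        rintro rfl
        exact nv.1 ⟨by omega, os⟩
      exact c.caseI (q := a) (by omega) (by omega) os ox
    · have : b ≠ B := by
        rintro rfl
        exact nv.2 ⟨by omega, os⟩
      exact c.swap.caseI (q := b) (by omega) (by omega) os ox

theorem Core.false (c : Core A B s t x y z) (hA : 0 ≤ A) (hB : 0 ≤ B) : False := by
  have n1 : ∀ {s t x y z : PS}, Core A B s t x y z → TipOn A B s x ∨ TipOn A B t x := by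
    intro s t x y z c
    rcases stepA c.rx c.dst c.dsx c.dtx c.msx c.mtx with h | h | h | h
    · exact (c.share hA hB h).elim
    · exact (c.swapST.share hA hB h).elim
    · exact Or.inl h
    · exact Or.inr h
  have h1 := n1 c
  have h2 := n1 c.swapXY
  have h3 := n1 c.swapYZ.swapXY
  have a1 : ¬ (TipOn A B s x ∧ TipOn A B s y) := fun h => c.nxy (tip_meet c.rs h.1 h.2)
  have a2 : ¬ (TipOn A B s x ∧ TipOn A B s z) := fun h => c.nxz (tip_meet c.rs h.1 h.2)
  have a3 : ¬ (TipOn A B s y ∧ TipOn A B s z) := fun h => c.nyz (tip_meet c.rs h.1 h.2)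
  have a4 : ¬ (TipOn A B t x ∧ TipOn A B t y) := fun h => c.nxy (tip_meet c.rt h.1 h.2)
  have a5 : ¬ (TipOn A B t x ∧ TipOn A B t z) := fun h => c.nxz (tip_meet c.rt h.1 h.2)
  have a6 : ¬ (TipOn A B t y ∧ TipOn A B t z) := fun h => c.nyz (tip_meet c.rt h.1 h.2)
  tauto

end

/-! ## From lists to shapes -/

/-- `l` traces the straight segment from `(a, k)` to `(b, k)` (horizontal). -/
def HSeg (l : List (ℤ × ℤ)) (a b k : ℤ) : Prop :=
  l.head? = some (a, k) ∧ l.getLast? = some (b, k) ∧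
  (∀ p, p ∈ l ↔ p.2 = k ∧ Bw a b p.1)

def VSeg (l : List (ℤ × ℤ)) (a b k : ℤ) : Prop :=
  l.head? = some (k, a) ∧ l.getLast? = some (k, b) ∧
  (∀ p, p ∈ l ↔ p.1 = k ∧ Bw a b p.2)

def NoBend (l : List (ℤ × ℤ)) : Prop :=
  ∀ a p c : ℤ × ℤ, [a, p, c] <:+: l → a.1 = c.1 ∨ a.2 = c.2

def Induced (l : List (ℤ × ℤ)) : Prop :=
  ∀ p q, p ∈ l → q ∈ l → GridStep p q → ConsecIn l p q

theorem ConsecIn.mono {l l' : List (ℤ × ℤ)} {p q : ℤ × ℤ} (h : ConsecIn l p q) (hl : l <:+: l') :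
    ConsecIn l' p q := h.imp (fun h => h.trans hl) (fun h => h.trans hl)

theorem ConsecIn.symm {l : List (ℤ × ℤ)} {p q : ℤ × ℤ} (h : ConsecIn l p q) :
    ConsecIn l q p := Or.symm h

theorem GridStep.symm {p q : ℤ × ℤ} (h : GridStep p q) : GridStep q p := by
  unfold GridStep at *
  omega

/-- Adding a new head to an induced list. -/
theorem Induced.cons {p q : ℤ × ℤ} {l : List (ℤ × ℤ)} (h : Induced (q :: l))
    (hp : ∀ r ∈ q :: l, GridStep p r → r = q) : Induced (p :: q :: l) := by
  have key : ∀ r ∈ q :: l, GridStep p r → ConsecIn (p :: q :: l) p r := by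
    intro r hr hs
    obtain rfl := hp r hr hs
    exact Or.inl ⟨[], l, by simp⟩
  have irr : ¬ GridStep p p := by simp [GridStep]
  intro a b ha hb hs
  rcases List.mem_cons.1 ha with rfl | ha'
  · rcases List.mem_cons.1 hb with rfl | hb'
    · exact (irr hs).elim
    · exact key b hb' hs
  · rcases List.mem_cons.1 hb with rfl | hb'
    · exact (key a ha' hs.symm).symm
    · exact (h a b ha' hb' hs).mono ⟨[p], [], by simp⟩

theorem straight : ∀ (l : List (ℤ × ℤ)) (p q : ℤ × ℤ), (p :: q :: l).IsChain GridStep →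
    (p :: q :: l).Nodup → NoBend (p :: q :: l) →
    ((∃ b, HSeg (p :: q :: l) p.1 b p.2 ∧ b ≠ p.1) ∨
      (∃ b, VSeg (p :: q :: l) p.2 b p.1 ∧ b ≠ p.2)) ∧ Induced (p :: q :: l) := by
  intro l
  induction l with
  | nil =>
    intro p q hc hn hb
    have hs : GridStep p q := by simpa using hc
    constructor
    · obtain ⟨p1, p2⟩ := p
      obtain ⟨q1, q2⟩ := q
      simp only [GridStep] at hs
      by_cases e : p2 = q2
      · subst e
        refine Or.inl ⟨q1, ⟨by simp, by simp, ?_⟩, by simp; omega⟩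
        rintro ⟨x, y⟩
        simp only [List.mem_cons, List.not_mem_nil, or_false, Prod.mk.injEq, Bw]
        omega
      · have e : p1 = q1 := by omega
        subst e
        refine Or.inr ⟨q2, ⟨by simp, by simp, ?_⟩, by simp; omega⟩
        rintro ⟨x, y⟩
        simp only [List.mem_cons, List.not_mem_nil, or_false, Prod.mk.injEq, Bw]
        omega
    · refine Induced.cons ?_ (by simp)
      intro a b ha hb hab
      rw [List.mem_singleton] at ha hb
      rw [ha, hb] at hab
      simp [GridStep] at hab
  | cons r l ih =>
    intro p q hc hn hb
    have hs : GridStep p q := (List.isChain_cons_cons.1 hc).1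
    have hc' := (List.isChain_cons_cons.1 hc).2
    have hs' : GridStep q r := (List.isChain_cons_cons.1 hc').1
    have hn' := (List.nodup_cons.1 hn).2
    have hpn := (List.nodup_cons.1 hn).1
    have hpr : p ≠ r := by
      rintro rfl
      simp at hpn
    have hbend := hb p q r ⟨[], l, by simp⟩
    have hb' : NoBend (q :: r :: l) := fun a b c h => hb a b c (h.trans ⟨[p], [], by simp⟩)
    obtain ⟨h1, h2⟩ := ih q r hc' hn' hb'
    have hr : r ∈ q :: r :: l := by simp
    obtain ⟨p1, p2⟩ := p
    obtain ⟨q1, q2⟩ := q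
    obtain ⟨r1, r2⟩ := r
    simp only [GridStep, ne_eq, Prod.mk.injEq] at hs hs' hpr hbend
    rcases h1 with ⟨b, ⟨a1, a2, a3⟩, a4⟩ | ⟨b, ⟨a1, a2, a3⟩, a4⟩
    · rw [a3] at hpn hr
      simp only [Bw] at hpn hr a3 a4
      have e : p2 = q2 := by omega
      subst e
      constructor
      · refine Or.inl ⟨b, ⟨by simp, by rw [List.getLast?_cons_cons]; exact a2, ?_⟩, ?_⟩
        · rintro ⟨x, y⟩
          rw [List.mem_cons, a3]
          simp only [Prod.mk.injEq, Bw]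
          omega
        · simp only
          omega
      · refine Induced.cons h2 ?_
        rintro ⟨x, y⟩ hx hg
        rw [a3] at hx
        simp only [GridStep, Prod.mk.injEq] at *
        omega
    · rw [a3] at hpn hr
      simp only [Bw] at hpn hr a3 a4
      have e : p1 = q1 := by omega
      subst e
      constructor
      · refine Or.inr ⟨b, ⟨by simp, by rw [List.getLast?_cons_cons]; exact a2, ?_⟩, ?_⟩
        · rintro ⟨x, y⟩
          rw [List.mem_cons, a3]
          simp only [Prod.mk.injEq, Bw]
          omega
        · simp only
          omega
      · refine Induced.cons h2 ?_
        rintro ⟨x, y⟩ hx hg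
        rw [a3] at hx
        simp only [GridStep, Prod.mk.injEq] at *
        omega

/-- The shape with corner `(cx, cy)` and endpoints `(hx, cy)`, `(cx, vy)`. -/
def mkL (cx cy hx vy : ℤ) : PS :=
  ⟨fun x y => (y = cy ∧ Bw cx hx x) ∨ (x = cx ∧ Bw cy vy y),
   fun x y => (x = hx ∧ y = cy) ∨ (x = cx ∧ y = vy)⟩

def LShape (w : PS) : Prop := ∃ cx cy hx vy, w = mkL cx cy hx vy ∧ (hx ≠ cx ∨ vy ≠ cy)

def GridPath.shape (P : GridPath) : PS :=
  ⟨fun x y => (x, y) ∈ P.toSet, fun x y => P.IsEndpoint (x, y)⟩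

theorem GridPath.first_eq (P : GridPath) {p : ℤ × ℤ} (h : P.pts.head? = some p) :
    P.first = p := by
  have := List.head?_eq_some_head P.ne_nil
  rw [h] at this
  exact (Option.some.inj this).symm

theorem GridPath.last_eq (P : GridPath) {p : ℤ × ℤ} (h : P.pts.getLast? = some p) :
    P.last = p := by
  have := List.getLast?_eq_some_getLast P.ne_nil
  rw [h] at this
  exact (Option.some.inj this).symm

theorem shape_eq (P : GridPath) {cx cy hx vy : ℤ}
    (h : ∀ p : ℤ × ℤ, p ∈ P.pts ↔ (p.2 = cy ∧ Bw cx hx p.1) ∨ (p.1 = cx ∧ Bw cy vy p.2))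
    (he : ∀ x y : ℤ, ((x, y) = P.first ∨ (x, y) = P.last) ↔
      (x = hx ∧ y = cy) ∨ (x = cx ∧ y = vy)) :
    P.shape = mkL cx cy hx vy := by
  simp only [GridPath.shape, mkL, PS.mk.injEq]
  constructor
  · funext x y
    exact propext (h (x, y))
  · funext x y
    exact propext (he x y)

theorem shape_straight (P : GridPath) (hb : NoBend P.pts) :
    LShape P.shape ∧ Induced P.pts := by
  obtain ⟨l, h2, hc, hn⟩ := P
  match l, h2 with
  | p :: q :: l, h2 =>
    obtain ⟨h1, hi⟩ := straight l p q hc hn hb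
    refine ⟨?_, hi⟩
    obtain ⟨p1, p2⟩ := p
    rcases h1 with ⟨b, ⟨a1, a2, a3⟩, a4⟩ | ⟨b, ⟨a1, a2, a3⟩, a4⟩
    · refine ⟨p1, p2, b, p2, shape_eq _ ?_ ?_, Or.inl a4⟩
      · intro p
        rw [a3]
        simp only [Bw]
        omega
      · intro x y
        rw [GridPath.first_eq _ a1, GridPath.last_eq _ a2]
        simp only [Prod.mk.injEq]
        omega
    · refine ⟨p1, p2, p1, b, shape_eq _ ?_ ?_, Or.inr a4⟩
      · intro p
        rw [a3]
        simp only [Bw]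
        omega
      · intro x y
        rw [GridPath.first_eq _ a1, GridPath.last_eq _ a2]
        simp only [Prod.mk.injEq]

theorem NoBend.reverse {l : List (ℤ × ℤ)} (h : NoBend l) : NoBend l.reverse := by
  intro a p c hi
  have : [c, p, a] <:+: l := by
    have := List.reverse_infix.2 hi
    simpa using this
  rcases h _ _ _ this with h | h
  · exact Or.inl h.symm
  · exact Or.inr h.symm

theorem Induced.reverse {l : List (ℤ × ℤ)} (h : Induced l) : Induced l.reverse := by
  intro p q hp hq hs
  rcases h p q (by simpa using hp) (by simpa using hq) hs with h | h
  · right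
    have := List.reverse_infix.2 h
    simpa using this
  · left
    have := List.reverse_infix.2 h
    simpa using this

theorem GridPath.shape_of_bends (P : GridPath) (hb : P.BendsAtMost 1) :
    LShape P.shape ∧ Induced P.pts := by
  by_cases nb : NoBend P.pts
  · exact shape_straight P nb
  unfold NoBend at nb
  push Not at nb
  obtain ⟨a, b, c, ⟨l1, l2, hl⟩, hac1, hac2⟩ := nb
  have hfin : P.bendSet.Finite := by
    refine Set.Finite.subset (List.finite_toSet P.pts) ?_
    rintro p ⟨a, c, h, -⟩
    exact h.subset (by simp)
  have hsub : ∀ p ∈ P.bendSet, p = b := by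
    intro p hp
    exact (Set.ncard_le_one hfin).1 hb p hp b ⟨a, c, ⟨l1, l2, hl⟩, hac1, hac2⟩
  have hn := P.nodup
  have hc : P.pts.IsChain GridStep := P.step
  -- the second half
  have i2 : (b :: c :: l2) <:+: P.pts := ⟨l1 ++ [a], [], by rw [← hl]; simp⟩
  have i1 : (l1 ++ [a, b]) <:+: P.pts := ⟨[], c :: l2, by rw [← hl]; simp⟩
  have hp2 : P.pts = (l1 ++ [a]) ++ (b :: c :: l2) := by rw [← hl]; simp
  have hp1 : P.pts = (l1 ++ [a, b]) ++ (c :: l2) := by rw [← hl]; simp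
  have n2 : (b :: c :: l2).Nodup := hn.sublist i2.sublist
  have n1 : (l1 ++ [a, b]).Nodup := hn.sublist i1.sublist
  have c2 : (b :: c :: l2).IsChain GridStep := hc.infix i2
  have c1 : (l1 ++ [a, b]).IsChain GridStep := hc.infix i1
  have nb2 : NoBend (b :: c :: l2) := by
    rintro a' p c' ⟨u, w, h⟩
    by_contra hcon
    push Not at hcon
    have e := hsub p ⟨a', c', (List.IsInfix.trans ⟨u, w, h⟩ i2), hcon⟩
    subst e
    rw [← h] at n2
    rcases u with _ | ⟨u0, u⟩
    · simp only [List.nil_append, List.cons_append, List.cons.injEq] at h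
      obtain ⟨rfl, -⟩ := h
      simp at n2
    · simp only [List.cons_append, List.cons.injEq] at h
      obtain ⟨rfl, -⟩ := h
      simp at n2
  have nb1 : NoBend (l1 ++ [a, b]) := by
    rintro a' p c' ⟨u, w, h⟩
    by_contra hcon
    push Not at hcon
    have e := hsub p ⟨a', c', (List.IsInfix.trans ⟨u, w, h⟩ i1), hcon⟩
    subst e
    have h' := congrArg List.reverse h
    rw [← h] at n1
    have n1' := List.nodup_reverse.2 n1
    simp only [List.reverse_append, List.reverse_cons, List.reverse_nil, List.nil_append,
      List.cons_append, List.append_assoc] at h' n1'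
    generalize w.reverse = w' at h' n1'
    rcases w' with _ | ⟨w0, w'⟩
    · simp only [List.nil_append, List.cons.injEq] at h'
      obtain ⟨rfl, -⟩ := h'
      simp at n1'
    · simp only [List.cons_append, List.cons.injEq] at h'
      obtain ⟨rfl, -⟩ := h'
      simp at n1'
  have rev : (l1 ++ [a, b]).reverse = b :: a :: l1.reverse := by simp
  have r1 := straight l1.reverse b a
    (by
      rw [← rev, List.isChain_reverse]
      exact c1.imp (fun _ _ h => h.symm))
    (by rw [← rev]; exact List.nodup_reverse.2 n1)
    (by rw [← rev]; exact nb1.reverse)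
  have r2 := straight l2 b c c2 n2 nb2
  obtain ⟨r1, d1⟩ := r1
  obtain ⟨r2, d2⟩ := r2
  have d1' : Induced (l1 ++ [a, b]) := by
    have := d1.reverse
    rw [← rev, List.reverse_reverse] at this
    exact this
  have mem : ∀ p, p ∈ P.pts ↔ p ∈ b :: a :: l1.reverse ∨ p ∈ b :: c :: l2 := by
    intro p
    rw [hp2]
    simp
    tauto
  have cons1 : ∀ p q, p ∈ b :: a :: l1.reverse → q ∈ b :: a :: l1.reverse → GridStep p q →
      ConsecIn P.pts p q := by
    intro p q hp hq hs
    rw [← rev, List.mem_reverse] at hp hq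
    exact (d1' p q hp hq hs).mono i1
  have cons2 : ∀ p q, p ∈ b :: c :: l2 → q ∈ b :: c :: l2 → GridStep p q →
      ConsecIn P.pts p q := by
    intro p q hp hq hs
    exact (d2 p q hp hq hs).mono i2
  have b1 : b ∈ b :: a :: l1.reverse := by simp
  have b2 : b ∈ b :: c :: l2 := by simp
  have ha : a ∈ b :: a :: l1.reverse := by simp
  have hc' : c ∈ b :: c :: l2 := by simp
  have lastP : ∀ p, (b :: c :: l2).getLast? = some p → P.last = p := by
    intro p h
    apply P.last_eq
    rw [hp2, List.getLast?_append, h]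
    simp
  have firstP : ∀ p, (b :: a :: l1.reverse).getLast? = some p → P.first = p := by
    intro p h
    apply P.first_eq
    rw [← rev, List.getLast?_reverse] at h
    rw [hp1, List.head?_append, h]
    simp
  have hind : (∀ p q, p ∈ b :: a :: l1.reverse → q ∈ b :: c :: l2 → GridStep p q →
      p = b ∨ q = b) → Induced P.pts := by
    intro hg p q hp hq hs
    rw [mem] at hp hq
    rcases hp with hp | hp <;> rcases hq with hq | hq
    · exact cons1 p q hp hq hs
    · rcases hg p q hp hq hs with rfl | rfl
      · exact cons2 _ _ b2 hq hs
      · exact cons1 _ _ hp b1 hs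
    · rcases hg q p hq hp hs.symm with rfl | rfl
      · exact cons2 _ _ hp b2 hs
      · exact cons1 _ _ b1 hq hs
    · exact cons2 p q hp hq hs
  obtain ⟨bx, bY⟩ := b
  rcases r1 with ⟨e, ⟨-, g1, g2⟩, g3⟩ | ⟨e, ⟨-, g1, g2⟩, g3⟩ <;>
  rcases r2 with ⟨e', ⟨-, k1, k2⟩, k3⟩ | ⟨e', ⟨-, k1, k2⟩, k3⟩
  · rw [g2] at ha
    rw [k2] at hc'
    omega
  · refine ⟨⟨bx, bY, e, e', shape_eq P ?_ ?_, Or.inl g3⟩, hind ?_⟩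
    · intro p
      rw [mem, g2, k2]
    · intro x y
      rw [lastP _ k1, firstP _ g1]
      simp only [Prod.mk.injEq]
    · rintro ⟨p1, p2⟩ ⟨q1, q2⟩ hp hq hs
      rw [g2] at hp
      rw [k2] at hq
      simp only [GridStep, Prod.mk.injEq, Bw] at *
      omega
  · refine ⟨⟨bx, bY, e', e, shape_eq P ?_ ?_, Or.inl k3⟩, hind ?_⟩
    · intro p
      rw [mem, g2, k2]
      exact or_comm
    · intro x y
      rw [lastP _ k1, firstP _ g1]
      simp only [Prod.mk.injEq]
      exact or_comm
    · rintro ⟨p1, p2⟩ ⟨q1, q2⟩ hp hq hs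
      rw [g2] at hp
      rw [k2] at hq
      simp only [GridStep, Prod.mk.injEq, Bw] at *
      omega
  · rw [g2] at ha
    rw [k2] at hc'
    omega

/-! ## Normalisation of the path of `v` -/

theorem swap_mkL (cx cy hx vy : ℤ) : (mkL cx cy hx vy).swap = mkL cy cx vy hx := by
  simp only [mkL, PS.swap, PS.mk.injEq]
  constructor
  · funext x y
    apply propext
    exact or_comm
  · funext x y
    apply propext
    omega

theorem vok_of {A B q h e : ℤ} (hA : 0 ≤ A) (hB : 0 ≤ B) (hq : 0 ≤ q)
    (h0 : h ≠ 0) (hv : ∀ a b, (mkL 0 0 A B).End a b → ¬ (mkV q h e).On a b)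
    (hqA : q ≤ A) (d : Dis (mkL 0 0 A B) (mkV q h e)) : VOK A B q h e := by
  have e1 := hv A 0
  have e2 := hv 0 B
  have i1 := d.vs 0 0
  have i2 := d.np 0 h
  clear d hv
  simp only [mkL, mkV, Bw, VOK, true_and, and_true, true_or, or_true, forall_const] at *
  omega

theorem rooted_aux {A B cx cy hx vy : ℤ} (hA : 0 ≤ A) (hB : 0 ≤ B)
    (hw : hx ≠ cx ∨ vy ≠ cy) (d : Dis (mkL 0 0 A B) (mkL cx cy hx vy))
    (hv : ∀ a b, (mkL 0 0 A B).End a b → ¬ (mkL cx cy hx vy).On a b)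
    (o : (mkL 0 0 A B).On cx vy) : Rooted A B (mkL cx cy hx vy) := by
  by_cases hc : cy = vy
  · subst hc
    have hw : hx ≠ cx := by tauto
    have c0 : cx = 0 := by
      have e1 := hv A 0
      have i1 := d.hs cx cy
      have i2 := d.hs (cx - 1) cy
      clear d hv
      simp only [mkL, Bw, true_and, and_true, true_or, or_true, forall_const] at *
      omega
    subst c0
    have e : mkL 0 cy hx cy = mkH cy hx cy := by
      simp only [mkL, mkH, PS.mk.injEq]
      constructor <;> funext x y <;> apply propext <;> (try simp only [Bw]) <;> omega
    right
    refine ⟨cy, hx, cy, e, ?_⟩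
    rw [e] at d hv
    have d' := d.swap
    rw [swap_mkL] at d'
    refine vok_of hB hA ?_ hw ?_ ?_ d'
    · clear d d' hv
      simp only [mkL, Bw] at *
      omega
    · intro a b h
      refine hv b a ?_
      rw [← swap_mkL] at h
      exact h
    · clear d d' hv
      simp only [mkL, Bw] at *
      omega
  · have c0 : vy = 0 := by
      have e1 := hv 0 B
      have i1 := d.vs cx vy
      have i2 := d.vs cx (vy - 1)
      clear d hv
      simp only [mkL, Bw, true_and, and_true, true_or, or_true, forall_const] at *
      omega
    subst c0
    have e : mkL cx cy hx 0 = mkV cx cy hx := by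
      simp only [mkL, mkV, PS.mk.injEq]
      constructor <;> funext x y <;> apply propext <;> (try simp only [Bw]) <;> omega
    left
    refine ⟨cx, cy, hx, e, ?_⟩
    rw [e] at d hv
    refine vok_of hA hB ?_ hc hv ?_ d
    · clear d hv
      simp only [mkL, Bw] at *
      omega
    · clear d hv
      simp only [mkL, Bw] at *
      omega

theorem rooted_of {A B : ℤ} {w : PS} (hA : 0 ≤ A) (hB : 0 ≤ B)
    (hw : LShape w) (d : Dis (mkL 0 0 A B) w) (m : Meet (mkL 0 0 A B) w)
    (hv : ∀ a b, (mkL 0 0 A B).End a b → ¬ w.On a b) : Rooted A B w := by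
  obtain ⟨cx, cy, hx, vy, rfl, hw⟩ := hw
  obtain ⟨a, b, o1, o2⟩ := m
  rcases d.pt a b o1 o2 with e | e
  · exact (hv a b e o2).elim
  rcases e with ⟨rfl, rfl⟩ | ⟨rfl, rfl⟩
  · have d' := d.swap
    rw [swap_mkL, swap_mkL] at d'
    have := rooted_aux hB hA (by tauto) d' (by
      intro a b h
      rw [← swap_mkL] at h
      rw [← swap_mkL]
      exact hv b a h) (by
      rw [← swap_mkL]
      exact o1)
    have := this.swap
    rw [swap_mkL] at this
    exact this
  · exact rooted_aux hA hB hw d hv o1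

/-- Reflection / translation of shapes. -/
def PS.tr (σ τ p q : ℤ) (w : PS) : PS :=
  ⟨fun x y => w.On (p + σ * x) (q + τ * y), fun x y => w.End (p + σ * x) (q + τ * y)⟩

def Sgn (σ : ℤ) : Prop := σ = 1 ∨ σ = -1

theorem Dis.tr {P Q : PS} (h : Dis P Q) {σ τ : ℤ} (hσ : Sgn σ) (hτ : Sgn τ) (p q : ℤ) :
    Dis (P.tr σ τ p q) (Q.tr σ τ p q) := by
  refine ⟨fun x y a b => h.pt _ _ a b, ?_, ?_⟩
  · rintro x y ⟨a, b, c, d⟩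
    simp only [PS.tr] at a b c d
    rcases hσ with rfl | rfl
    · have e : p + 1 * (x + 1) = p + 1 * x + 1 := by ring
      rw [e] at b d
      exact h.hs _ _ ⟨a, b, c, d⟩
    · have e : p + -1 * x = p + -1 * (x + 1) + 1 := by ring
      rw [e] at a c
      exact h.hs _ _ ⟨b, a, d, c⟩
  · rintro x y ⟨a, b, c, d⟩
    simp only [PS.tr] at a b c d
    rcases hτ with rfl | rfl
    · have e : q + 1 * (y + 1) = q + 1 * y + 1 := by ring
      rw [e] at b d
      exact h.vs _ _ ⟨a, b, c, d⟩
    · have e : q + -1 * y = q + -1 * (y + 1) + 1 := by ring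
      rw [e] at a c
      exact h.vs _ _ ⟨b, a, d, c⟩

theorem Meet.tr_iff {P Q : PS} {σ τ : ℤ} (hσ : Sgn σ) (hτ : Sgn τ) (p q : ℤ) :
    Meet (P.tr σ τ p q) (Q.tr σ τ p q) ↔ Meet P Q := by
  constructor
  · rintro ⟨x, y, a, b⟩
    exact ⟨_, _, a, b⟩
  · rintro ⟨x, y, a, b⟩
    have e1 : p + σ * (σ * (x - p)) = x := by
      rcases hσ with rfl | rfl <;> ring
    have e2 : q + τ * (τ * (y - q)) = y := by
      rcases hτ with rfl | rfl <;> ring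
    refine ⟨σ * (x - p), τ * (y - q), ?_, ?_⟩ <;> simp only [PS.tr, e1, e2] <;> assumption

theorem tr_mkL {σ τ : ℤ} (hσ : Sgn σ) (hτ : Sgn τ) (p q cx cy hx vy : ℤ) :
    (mkL cx cy hx vy).tr σ τ p q =
      mkL (σ * (cx - p)) (τ * (cy - q)) (σ * (hx - p)) (τ * (vy - q)) := by
  simp only [mkL, PS.tr, PS.mk.injEq]
  constructor
  · funext x y
    apply propext
    simp only [Bw]
    rcases hσ with rfl | rfl <;> rcases hτ with rfl | rfl <;> omega
  · funext x y
    apply propext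
    rcases hσ with rfl | rfl <;> rcases hτ with rfl | rfl <;> omega

theorem LShape.tr {w : PS} (h : LShape w) {σ τ : ℤ} (hσ : Sgn σ) (hτ : Sgn τ) (p q : ℤ) :
    LShape (w.tr σ τ p q) := by
  obtain ⟨cx, cy, hx, vy, rfl, h⟩ := h
  refine ⟨_, _, _, _, tr_mkL hσ hτ _ _ _ _ _ _, ?_⟩
  rcases hσ with rfl | rfl <;> rcases hτ with rfl | rfl <;> omega

/-- In a representation of `G(v)`, some endpoint of `P_v` is on another path. -/
theorem gadget {v s t a b c : PS}
    (hv : LShape v) (hw : ∀ w, w = s ∨ w = t ∨ w = a ∨ w = b ∨ w = c →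
      LShape w ∧ Dis v w ∧ Meet v w ∧ ∀ x y, v.End x y → ¬ w.On x y)
    (dst : Dis s t) (dsa : Dis s a) (dsb : Dis s b) (dsc : Dis s c)
    (dta : Dis t a) (dtb : Dis t b) (dtc : Dis t c)
    (mst : Meet s t) (msa : Meet s a) (msb : Meet s b) (msc : Meet s c)
    (mta : Meet t a) (mtb : Meet t b) (mtc : Meet t c)
    (nab : ¬ Meet a b) (nac : ¬ Meet a c) (nbc : ¬ Meet b c) : False := by
  obtain ⟨cx, cy, hx, vy, rfl, -⟩ := hv
  obtain ⟨σ, hσ, kσ⟩ : ∃ σ, Sgn σ ∧ 0 ≤ σ * (hx - cx) := by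
    rcases le_total cx hx with h | h
    · exact ⟨1, Or.inl rfl, by omega⟩
    · exact ⟨-1, Or.inr rfl, by omega⟩
  obtain ⟨τ, hτ, kτ⟩ : ∃ τ, Sgn τ ∧ 0 ≤ τ * (vy - cy) := by
    rcases le_total cy vy with h | h
    · exact ⟨1, Or.inl rfl, by omega⟩
    · exact ⟨-1, Or.inr rfl, by omega⟩
  have vt := tr_mkL hσ hτ cx cy cx cy hx vy
  rw [sub_self, mul_zero, sub_self, mul_zero] at vt
  have rt : ∀ w, w = s ∨ w = t ∨ w = a ∨ w = b ∨ w = c →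
      Rooted (σ * (hx - cx)) (τ * (vy - cy)) (w.tr σ τ cx cy) := by
    intro w h
    obtain ⟨h1, h2, h3, h4⟩ := hw w h
    refine rooted_of kσ kτ (h1.tr hσ hτ cx cy) ?_ ?_ ?_
    · rw [← vt]
      exact h2.tr hσ hτ cx cy
    · rw [← vt]
      exact (Meet.tr_iff hσ hτ cx cy).2 h3
    · rw [← vt]
      intro x y
      exact h4 _ _
  have M : ∀ {P Q : PS}, Meet P Q → Meet (P.tr σ τ cx cy) (Q.tr σ τ cx cy) :=
    fun h => (Meet.tr_iff hσ hτ cx cy).2 h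
  have N : ∀ {P Q : PS}, ¬ Meet P Q → ¬ Meet (P.tr σ τ cx cy) (Q.tr σ τ cx cy) :=
    fun h h' => h ((Meet.tr_iff hσ hτ cx cy).1 h')
  have D : ∀ {P Q : PS}, Dis P Q → Dis (P.tr σ τ cx cy) (Q.tr σ τ cx cy) :=
    fun h => h.tr hσ hτ cx cy
  have core : Core (σ * (hx - cx)) (τ * (vy - cy)) (s.tr σ τ cx cy) (t.tr σ τ cx cy)
      (a.tr σ τ cx cy) (b.tr σ τ cx cy) (c.tr σ τ cx cy) :=
    ⟨rt s (by tauto), rt t (by tauto), rt a (by tauto), rt b (by tauto), rt c (by tauto),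
     D dst, D dsa, D dsb, D dsc, D dta, D dtb, D dtc, M mst, M msa, M msb, M msc, M mta, M mtb,
     M mtc, N nab, N nac, N nbc⟩
  exact core.false kσ kτ

/-! ## The graph `E_1` -/

theorem rep_dis {V : Type*} {G : SimpleGraph V} (R : CPGRep G) (hR : R.BendsAtMost 1) {u w : V}
    (h : u ≠ w) : Dis (R.path u).shape (R.path w).shape := by
  refine ⟨fun x y a b => R.interiorly_disjoint u w h (x, y) a b, ?_, ?_⟩
  · rintro x y ⟨a, b, c, d⟩
    have hs : GridStep (x, y) (x + 1, y) := by
      simp only [GridStep]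
      omega
    exact R.no_shared_segment u w h _ _
      (((R.path u).shape_of_bends (hR u)).2 _ _ a b hs)
      (((R.path w).shape_of_bends (hR w)).2 _ _ c d hs)
  · rintro x y ⟨a, b, c, d⟩
    have hs : GridStep (x, y) (x, y + 1) := by
      simp only [GridStep]
      omega
    exact R.no_shared_segment u w h _ _
      (((R.path u).shape_of_bends (hR u)).2 _ _ a b hs)
      (((R.path w).shape_of_bends (hR w)).2 _ _ c d hs)

theorem rep_meet {V : Type*} {G : SimpleGraph V} (R : CPGRep G) {u w : V} (h : u ≠ w) :
    Meet (R.path u).shape (R.path w).shape ↔ G.Adj u w := by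
  rw [R.adj_iff u w h]
  constructor
  · rintro ⟨x, y, a, b⟩
    exact ⟨(x, y), a, b⟩
  · rintro ⟨⟨x, y⟩, a, b⟩
    exact ⟨x, y, a, b⟩

theorem E1_adj (u w : E1V) : E1.Adj u w ↔ u ≠ w ∧ (E1Rel u w ∨ E1Rel w u) :=
  SimpleGraph.fromRel_adj _ _ _

/-- The vertices of copy `i`. -/
def InCopy (i : Bool) (w : E1V) : Prop :=
  w = E1V.s i ∨ w = E1V.t i ∨ w = E1V.a i ∨ w = E1V.b i ∨ w = E1V.c i

theorem copy_touches (R : CPGRep E1) (hR : R.BendsAtMost 1) (i : Bool) :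
    ∃ w p, InCopy i w ∧ (R.path E1V.v).IsEndpoint p ∧ p ∈ (R.path w).toSet := by
  by_contra hcon
  have hcon' : ∀ w p, InCopy i w → (R.path E1V.v).IsEndpoint p → p ∉ (R.path w).toSet :=
    fun w p h1 h2 h3 => hcon ⟨w, p, h1, h2, h3⟩
  have D : ∀ {u w : E1V}, u ≠ w → Dis (R.path u).shape (R.path w).shape :=
    fun h => rep_dis R hR h
  have M : ∀ {u w : E1V}, u ≠ w → (E1Rel u w ∨ E1Rel w u) →
      Meet (R.path u).shape (R.path w).shape :=
    fun h h' => (rep_meet R h).2 ((E1_adj _ _).2 ⟨h, h'⟩)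
  have N : ∀ {u w : E1V}, u ≠ w → ¬ (E1Rel u w ∨ E1Rel w u) →
      ¬ Meet (R.path u).shape (R.path w).shape :=
    fun h h' m => h' ((E1_adj _ _).1 ((rep_meet R h).1 m)).2
  refine gadget (v := (R.path E1V.v).shape) (s := (R.path (E1V.s i)).shape)
    (t := (R.path (E1V.t i)).shape) (a := (R.path (E1V.a i)).shape)
    (b := (R.path (E1V.b i)).shape) (c := (R.path (E1V.c i)).shape)
    ((R.path E1V.v).shape_of_bends (hR _)).1 ?_
    (D (by simp)) (D (by simp)) (D (by simp)) (D (by simp)) (D (by simp)) (D (by simp))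
    (D (by simp))
    (M (by simp) (Or.inl (.st i))) (M (by simp) (Or.inr (.as' i))) (M (by simp) (Or.inr (.bs i)))
    (M (by simp) (Or.inr (.cs i))) (M (by simp) (Or.inr (.at' i))) (M (by simp) (Or.inr (.bt i)))
    (M (by simp) (Or.inr (.ct i)))
    (N (by simp) (by rintro (h | h) <;> cases h)) (N (by simp) (by rintro (h | h) <;> cases h))
    (N (by simp) (by rintro (h | h) <;> cases h))
  have key : ∀ u, InCopy i u → LShape (R.path u).shape ∧
      Dis (R.path E1V.v).shape (R.path u).shape ∧ Meet (R.path E1V.v).shape (R.path u).shape ∧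
      ∀ x y, (R.path E1V.v).shape.End x y → ¬ (R.path u).shape.On x y := by
    intro u hu
    have hne : E1V.v ≠ u := by
      rcases hu with rfl | rfl | rfl | rfl | rfl <;> simp
    refine ⟨((R.path u).shape_of_bends (hR _)).1, D hne, M hne ?_,
      fun x y h => hcon' u (x, y) hu h⟩
    rcases hu with rfl | rfl | rfl | rfl | rfl
    · exact Or.inl (.vs i)
    · exact Or.inr (.tv i)
    · exact Or.inr (.av i)
    · exact Or.inr (.bv i)
    · exact Or.inr (.cv i)
  rintro w (rfl | rfl | rfl | rfl | rfl)
  · exact key _ (Or.inl rfl)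
  · exact key _ (Or.inr (Or.inl rfl))
  · exact key _ (Or.inr (Or.inr (Or.inl rfl)))
  · exact key _ (Or.inr (Or.inr (Or.inr (Or.inl rfl))))
  · exact key _ (Or.inr (Or.inr (Or.inr (Or.inr rfl))))

theorem copies_disjoint (R : CPGRep E1) {u w : E1V} (hu : InCopy false u) (hw : InCopy true w)
    {p : ℤ × ℤ} (h1 : p ∈ (R.path u).toSet) (h2 : p ∈ (R.path w).toSet) : False := by
  have hne : u ≠ w := by
    rcases hu with rfl | rfl | rfl | rfl | rfl <;>
    rcases hw with rfl | rfl | rfl | rfl | rfl <;> simp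
  have adj := ((E1_adj _ _).1 ((R.adj_iff u w hne).2 ⟨p, h1, h2⟩)).2
  rcases hu with rfl | rfl | rfl | rfl | rfl <;>
  rcases hw with rfl | rfl | rfl | rfl | rfl <;>
  rcases adj with h | h <;> cases h

theorem InCopy.ne_v {i : Bool} {w : E1V} (h : InCopy i w) : w ≠ E1V.v := by
  rcases h with rfl | rfl | rfl | rfl | rfl <;> simp


/-- In every 1-bend CPG representation of `E_1`, the path `P_v` has no free endpoint:
each of its two endpoints belongs to some other path of the representation. -/
theorem E1_path_v_has_no_free_endpoint (R : CPGRep E1) (hR : R.BendsAtMost 1) :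
    ∀ p : ℤ × ℤ, (R.path E1V.v).IsEndpoint p →
      ∃ w : E1V, w ≠ E1V.v ∧ p ∈ (R.path w).toSet := by


  intro p hp
  obtain ⟨u, p0, hu, e0, m0⟩ := copy_touches R hR false
  obtain ⟨w, p1, hw, e1, m1⟩ := copy_touches R hR true
  by_cases h0 : p0 = p
  · exact ⟨u, hu.ne_v, h0 ▸ m0⟩
  by_cases h1 : p1 = p
  · exact ⟨w, hw.ne_v, h1 ▸ m1⟩
  exfalso
  have e : p0 = p1 := by
    rcases hp with rfl | rfl <;> rcases e0 with rfl | rfl <;> rcases e1 with rfl | rfl <;>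
    first | rfl | exact absurd rfl h0 | exact absurd rfl h1
  subst e
  exact copies_disjoint R hu hw m0 m1
end
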